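/- arXiv:0802.0512 — 3 statements merged into one kernel-verified Lean document; each statement's English description precedes it below -/
import Mathlib

section
/- Let g ≥ 2. The genus-g surface group π₁Σ_g is fully residually free: for every finite set S ⊆ π₁Σ_g with 1 ∉ S, there exists a group homomorphism φ : π₁Σ_g →* FreeGroup (Fin 2) such that φ s ≠ 1 for every s ∈ S. (Theorem 2.27 of the paper, due to G. Baumslag.) -/
/-- The single surface relator `∏ i, [aᵢ, bᵢ]` in the free group on `Fin g ⊕ Fin g`. -/
def surfaceRel (g : ℕ) : Set (FreeGroup (Fin g ⊕ Fin g)) :=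
  {(List.ofFn fun i : Fin g =>
      FreeGroup.of (Sum.inl i) * FreeGroup.of (Sum.inr i) *
        (FreeGroup.of (Sum.inl i))⁻¹ * (FreeGroup.of (Sum.inr i))⁻¹).prod}

/-- The fundamental group of the closed orientable surface of genus `g`. -/
abbrev SurfaceGroup (g : ℕ) : Type := PresentedGroup (surfaceRel g)

open scoped MatrixGroups commutatorElement

namespace PuncturedTorus

/-- Two generators of the commutator subgroup of `SL(2, ℤ)`, which uniformize a once-punctured
torus. -/
def gen : Fin 2 → SL(2, ℤ) :=
  ![⟨!![2, 1; 1, 1], by simp⟩, ⟨!![2, -1; -1, 1], by simp⟩]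

/-- The representation of the free group of rank two as the commutator subgroup of `SL(2, ℤ)`. -/
def rep : FreeGroup (Fin 2) →* SL(2, ℤ) := FreeGroup.lift gen

/-- The commutator of the two generators, representing the boundary of the punctured torus. -/
def bdry : FreeGroup (Fin 2) :=
  FreeGroup.of 0 * FreeGroup.of 1 * (FreeGroup.of 0)⁻¹ * (FreeGroup.of 1)⁻¹

lemma gen_zero_mul (M : SL(2, ℤ)) (j : Fin 2) :
    (gen 0 * M) 0 j = 2 * M 0 j + M 1 j ∧ (gen 0 * M) 1 j = M 0 j + M 1 j := by
  change ((gen 0).1 * M.1) 0 j = _ ∧ ((gen 0).1 * M.1) 1 j = _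
  simp [gen, Matrix.mul_apply]

lemma gen_one_mul (M : SL(2, ℤ)) (j : Fin 2) :
    (gen 1 * M) 0 j = 2 * M 0 j - M 1 j ∧ (gen 1 * M) 1 j = -M 0 j + M 1 j := by
  change ((gen 1).1 * M.1) 0 j = _ ∧ ((gen 1).1 * M.1) 1 j = _
  simp [gen, Matrix.mul_apply, sub_eq_add_neg]

lemma gen_zero_inv_mul (M : SL(2, ℤ)) (j : Fin 2) :
    ((gen 0)⁻¹ * M) 0 j = M 0 j - M 1 j ∧ ((gen 0)⁻¹ * M) 1 j = -M 0 j + 2 * M 1 j := by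
  have h := gen_zero_mul ((gen 0)⁻¹ * M) j
  rw [mul_inv_cancel_left] at h
  constructor <;> linarith

lemma gen_one_inv_mul (M : SL(2, ℤ)) (j : Fin 2) :
    ((gen 1)⁻¹ * M) 0 j = M 0 j + M 1 j ∧ ((gen 1)⁻¹ * M) 1 j = M 0 j + 2 * M 1 j := by
  have h := gen_one_mul ((gen 1)⁻¹ * M) j
  rw [mul_inv_cancel_left] at h
  constructor <;> linarith

lemma det_eq (M : SL(2, ℤ)) : M 0 0 * M 1 1 - M 0 1 * M 1 0 = 1 := by
  have h := M.2
  rwa [Matrix.det_fin_two] at h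

/-- Attracting ping-pong sets: first columns of slope in `[1, ∞)`, respectively `[∞, -1)`. -/
def attracting : Fin 2 → Set SL(2, ℤ) :=
  ![{M | 0 < M 1 0 ∧ M 1 0 ≤ M 0 0 ∨ M 1 0 < 0 ∧ M 0 0 ≤ M 1 0},
    {M | M 1 0 = 0 ∨ 0 < M 1 0 ∧ M 0 0 < -M 1 0 ∨ M 1 0 < 0 ∧ -M 1 0 < M 0 0}]

/-- Repelling ping-pong sets: first columns of slope in `[-1, 0)`, respectively `[0, 1)`. -/
def repelling : Fin 2 → Set SL(2, ℤ) :=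
  ![{M | 0 < M 1 0 ∧ -M 1 0 ≤ M 0 0 ∧ M 0 0 < 0 ∨ M 1 0 < 0 ∧ 0 < M 0 0 ∧ M 0 0 ≤ -M 1 0},
    {M | 0 < M 1 0 ∧ 0 ≤ M 0 0 ∧ M 0 0 < M 1 0 ∨ M 1 0 < 0 ∧ M 0 0 ≤ 0 ∧ M 1 0 < M 0 0}]

lemma col_ne_zero (M : SL(2, ℤ)) : ¬(M 0 0 = 0 ∧ M 1 0 = 0) := by
  rintro ⟨h0, h1⟩
  have := det_eq M
  simp [h0, h1] at this

set_option linter.unusedSimpArgs false in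
lemma rep_injective : Function.Injective rep := by
  refine FreeGroup.injective_lift_of_ping_pong gen attracting repelling ?_ ?_ ?_ ?_ ?_ ?_
  · intro i
    fin_cases i
    · refine ⟨gen 0, ?_⟩
      change 0 < (1 : ℤ) ∧ (1 : ℤ) ≤ 2 ∨ _
      omega
    · exact ⟨1, by simp [attracting]⟩
  · intro i j hij
    rw [Function.onFun, Set.disjoint_left]
    intro M
    fin_cases i <;> fin_cases j <;> simp [attracting] at hij ⊢ <;> omega
  · intro i j hij
    rw [Function.onFun, Set.disjoint_left]
    intro M
    fin_cases i <;> fin_cases j <;> simp [repelling] at hij ⊢ <;> omega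
  · intro i j
    rw [Set.disjoint_left]
    intro M
    fin_cases i <;> fin_cases j <;> simp [attracting, repelling] <;> omega
  · intro i
    rintro _ ⟨M, hM, rfl⟩
    have hc := col_ne_zero M
    fin_cases i
    · have h := gen_zero_mul M 0
      simp only [Fin.zero_eta, attracting, repelling, Matrix.cons_val_zero, Matrix.cons_val_one,
        Matrix.cons_val_fin_one, Set.mem_compl_iff, Set.mem_ofPred_eq, smul_eq_mul,
        Pi.inv_apply] at hM ⊢
      omega
    · have h := gen_one_mul M 0
      simp only [Fin.mk_one, attracting, repelling, Matrix.cons_val_zero, Matrix.cons_val_one,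
        Matrix.cons_val_fin_one, Set.mem_compl_iff, Set.mem_ofPred_eq, smul_eq_mul,
        Pi.inv_apply] at hM ⊢
      omega
  · intro i
    rintro _ ⟨M, hM, rfl⟩
    have hc := col_ne_zero M
    fin_cases i
    · have h := gen_zero_inv_mul M 0
      simp only [Fin.zero_eta, attracting, repelling, Matrix.cons_val_zero, Matrix.cons_val_one,
        Matrix.cons_val_fin_one, Set.mem_compl_iff, Set.mem_ofPred_eq, smul_eq_mul,
        Pi.inv_apply] at hM ⊢
      omega
    · have h := gen_one_inv_mul M 0
      simp only [Fin.mk_one, attracting, repelling, Matrix.cons_val_zero, Matrix.cons_val_one,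
        Matrix.cons_val_fin_one, Set.mem_compl_iff, Set.mem_ofPred_eq, smul_eq_mul,
        Pi.inv_apply] at hM ⊢
      omega

lemma rep_bdry_zpow_mul (m : ℤ) : ∃ ε : ℤ, (ε = 1 ∨ ε = -1) ∧ ∀ (M : SL(2, ℤ)) (j : Fin 2),
    (rep (bdry ^ m) * M) 0 j = ε * (M 0 j + 6 * m * M 1 j) ∧
      (rep (bdry ^ m) * M) 1 j = ε * M 1 j := by
  have key (M : SL(2, ℤ)) (j : Fin 2) : (rep bdry * M) 0 j = -(M 0 j + 6 * M 1 j) ∧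
      (rep bdry * M) 1 j = -M 1 j := by
    have e : rep bdry * M = gen 0 * (gen 1 * ((gen 0)⁻¹ * ((gen 1)⁻¹ * M))) := by
      simp [rep, bdry, mul_assoc]
    rw [e, (gen_zero_mul _ _).1, (gen_zero_mul _ _).2, (gen_one_mul _ _).1, (gen_one_mul _ _).2,
      (gen_zero_inv_mul _ _).1, (gen_zero_inv_mul _ _).2, (gen_one_inv_mul _ _).1,
      (gen_one_inv_mul _ _).2]
    constructor <;> ring
  have key' (M : SL(2, ℤ)) (j : Fin 2) : ((rep bdry)⁻¹ * M) 0 j = -(M 0 j - 6 * M 1 j) ∧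
      ((rep bdry)⁻¹ * M) 1 j = -M 1 j := by
    have h := key ((rep bdry)⁻¹ * M) j
    rw [mul_inv_cancel_left] at h
    constructor <;> linarith
  induction m with
  | zero => exact ⟨1, by simp⟩
  | succ m ih =>
    obtain ⟨ε, hε, h⟩ := ih
    refine ⟨-ε, by grind, fun M j => ?_⟩
    rw [zpow_add_one, map_mul, mul_assoc, (h _ _).1, (h _ _).2, (key _ _).1, (key _ _).2]
    exact ⟨by ring, by ring⟩
  | pred m ih =>
    obtain ⟨ε, hε, h⟩ := ih
    refine ⟨-ε, by grind, fun M j => ?_⟩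
    rw [zpow_sub_one, map_mul, map_inv, mul_assoc, (h _ _).1, (h _ _).2, (key' _ _).1,
      (key' _ _).2]
    exact ⟨by ring, by ring⟩

lemma rep_induction {P : SL(2, ℤ) → Prop} (one : P 1) (mul : ∀ i M, P M → P (gen i * M))
    (inv_mul : ∀ i M, P M → P ((gen i)⁻¹ * M)) (h : FreeGroup (Fin 2)) : P (rep h) := by
  suffices ∀ M, P M → P (rep h * M) by simpa using this 1 one
  induction h using FreeGroup.induction_on with
  | C1 => simp
  | of i => simpa [rep] using mul i
  | inv_of i _ => simpa [rep] using inv_mul i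
  | mul x y hx hy => exact fun M hM => by simpa [mul_assoc] using hx _ (hy _ hM)

/-- A character `SL(2, ℤ) → ZMod 4` in terms of matrix entries. -/
def charFour (a b c d : ZMod 4) : ZMod 4 :=
  (1 - c ^ 2) * (b * d + 3 * (c - 1) * d + c + 3) + c * (a + d - 3)

lemma charFour_rep (h : FreeGroup (Fin 2)) :
    charFour (rep h 0 0) (rep h 0 1) (rep h 1 0) (rep h 1 1) = 0 := by
  have key : ∀ a b c d : ZMod 4, a * d - b * c = 1 → charFour a b c d = 0 →
      charFour (2 * a + c) (2 * b + d) (a + c) (b + d) = 0 ∧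
      charFour (2 * a - c) (2 * b - d) (-a + c) (-b + d) = 0 ∧
      charFour (a - c) (b - d) (-a + 2 * c) (-b + 2 * d) = 0 ∧
      charFour (a + c) (b + d) (a + 2 * c) (b + 2 * d) = 0 := by decide
  have det (M : SL(2, ℤ)) : (M 0 0 : ZMod 4) * M 1 1 - M 0 1 * M 1 0 = 1 := by
    exact_mod_cast congrArg (Int.cast : ℤ → ZMod 4) (det_eq M)
  refine rep_induction (P := fun M => charFour (M 0 0) (M 0 1) (M 1 0) (M 1 1) = 0)
    (by simp [charFour]) ?_ ?_ h
  · intro i M hM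
    have := key _ _ _ _ (det M) hM
    fin_cases i
    · simpa [gen_zero_mul] using this.1
    · simpa [gen_one_mul] using this.2.1
  · intro i M hM
    have := key _ _ _ _ (det M) hM
    fin_cases i
    · simpa [gen_zero_inv_mul] using this.2.2.1
    · simpa [gen_one_inv_mul] using this.2.2.2

/-- Modulo `3`, the representation takes values in the quaternion subgroup. -/
lemma rep_mod_three (h : FreeGroup (Fin 2)) :
    ((rep h 0 1 : ZMod 3) = 0 ∧ (rep h 1 0 : ZMod 3) = 0) ∨
      (rep h 0 0 : ZMod 3) + rep h 1 1 = 0 := by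
  have key : ∀ a b c d : ZMod 3, a * d - b * c = 1 → (b = 0 ∧ c = 0) ∨ a + d = 0 →
      ((2 * b + d = 0 ∧ a + c = 0) ∨ (2 * a + c) + (b + d) = 0) ∧
      ((2 * b - d = 0 ∧ -a + c = 0) ∨ (2 * a - c) + (-b + d) = 0) ∧
      ((b - d = 0 ∧ -a + 2 * c = 0) ∨ (a - c) + (-b + 2 * d) = 0) ∧
      ((b + d = 0 ∧ a + 2 * c = 0) ∨ (a + c) + (b + 2 * d) = 0) := by decide
  have det (M : SL(2, ℤ)) : (M 0 0 : ZMod 3) * M 1 1 - M 0 1 * M 1 0 = 1 := by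
    exact_mod_cast congrArg (Int.cast : ℤ → ZMod 3) (det_eq M)
  refine rep_induction (P := fun M => ((M 0 1 : ZMod 3) = 0 ∧ (M 1 0 : ZMod 3) = 0) ∨
      (M 0 0 : ZMod 3) + M 1 1 = 0) (by simp) ?_ ?_ h
  · intro i M hM
    have := key _ _ _ _ (det M) hM
    fin_cases i
    · simpa [gen_zero_mul] using this.1
    · simpa [gen_one_mul] using this.2.1
  · intro i M hM
    have := key _ _ _ _ (det M) hM
    fin_cases i
    · simpa [gen_zero_inv_mul] using this.2.2.1
    · simpa [gen_one_inv_mul] using this.2.2.2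

/-- The stabilizer of the cusp `∞` is generated by the boundary. -/
lemma exists_eq_bdry_zpow {h : FreeGroup (Fin 2)} (hh : rep h 1 0 = 0) :
    ∃ k : ℤ, h = bdry ^ k := by
  have hd := det_eq (rep h)
  rw [hh, mul_zero, sub_zero] at hd
  obtain ⟨ε, hε, h0, h1⟩ : ∃ ε : ℤ, (ε = 1 ∨ ε = -1) ∧ rep h 0 0 = ε ∧ rep h 1 1 = ε := by
    rcases Int.mul_eq_one_iff_eq_one_or_neg_one.1 hd with h | h
    · exact ⟨1, by simp [h]⟩
    · exact ⟨-1, by simp [h]⟩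
  obtain ⟨t, ht⟩ : 6 ∣ rep h 0 1 := by
    have d3 : (3 : ℤ) ∣ rep h 0 1 := by
      have h3 := rep_mod_three h
      rw [h0, h1] at h3
      refine (ZMod.intCast_zmod_eq_zero_iff_dvd _ 3).1 (h3.resolve_right ?_).1
      rcases hε with rfl | rfl <;> decide
    have d2 : (2 : ℤ) ∣ rep h 0 1 := by
      have h4 := charFour_rep h
      rw [h0, h1, hh] at h4
      have h2 : ((2 * rep h 0 1 : ℤ) : ZMod 4) = 0 := by
        push_cast
        revert h4
        generalize ((rep h 0 1 : ℤ) : ZMod 4) = x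
        revert x
        rcases hε with rfl | rfl <;> decide
      have := (ZMod.intCast_zmod_eq_zero_iff_dvd _ 4).1 h2
      push_cast at this
      omega
    omega
  refine ⟨ε * t, ?_⟩
  suffices bdry ^ (-(ε * t)) * h = 1 by
    rwa [zpow_neg, inv_mul_eq_one, eq_comm] at this
  obtain ⟨δ, hδ, hmul⟩ := rep_bdry_zpow_mul (-(ε * t))
  apply rep_injective
  set M := rep (bdry ^ (-(ε * t)) * h) with hM
  rw [map_mul] at hM
  have h00 : M 0 0 = δ * ε := by rw [hM, (hmul _ _).1, h0, hh]; ring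
  have h01 : M 0 1 = 0 := by
    rw [hM, (hmul _ _).1, h1, ht]
    rcases hε with rfl | rfl <;> ring
  have h10 : M 1 0 = 0 := by rw [hM, (hmul _ _).2, hh, mul_zero]
  have h11 : M 1 1 = δ * ε := by rw [hM, (hmul _ _).2, h1]
  have hη : δ * ε = 1 := by
    have h4 : charFour (M 0 0) (M 0 1) (M 1 0) (M 1 1) = 0 := charFour_rep _
    rw [h00, h01, h10, h11] at h4
    have : δ * ε = 1 ∨ δ * ε = -1 := by grind
    refine this.resolve_right fun h' => ?_
    rw [h'] at h4
    revert h4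
    decide
  rw [hη] at h00 h11
  ext i j
  fin_cases i <;> fin_cases j <;> simp [h00, h01, h10, h11]

/-- The first column of `M` has slope at most `K`, so that it stays away from the cusp `∞`. -/
def SlopeLE (K : ℤ) (M : SL(2, ℤ)) : Prop := M 1 0 ≠ 0 ∧ |M 0 0| ≤ K * |M 1 0|

lemma exists_slopeLE (M : SL(2, ℤ)) (hM : M 1 0 ≠ 0) : ∃ K, SlopeLE K M :=
  ⟨|M 0 0|, hM, le_mul_of_one_le_right (abs_nonneg _) (Int.one_le_abs hM)⟩

lemma SlopeLE.mul_bdry_zpow {K : ℤ} {h : FreeGroup (Fin 2)} (hh : SlopeLE K (rep h)) (n : ℤ) :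
    SlopeLE K (rep (h * bdry ^ n)) := by
  obtain ⟨ε, hε, hmul⟩ := rep_bdry_zpow_mul n
  have h0 : rep (bdry ^ n) 0 0 = ε := by simpa using (hmul 1 0).1
  have h1 : rep (bdry ^ n) 1 0 = 0 := by simpa using (hmul 1 0).2
  have e (i : Fin 2) : rep (h * bdry ^ n) i 0 = rep h i 0 * ε := by
    rw [map_mul]
    change ((rep h).1 * (rep (bdry ^ n)).1) i 0 = _
    simp [Matrix.mul_apply, -map_zpow, h0, h1]
  rw [SlopeLE, e, e]
  rcases hε with rfl | rfl <;> simpa [SlopeLE] using hh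

lemma SlopeLE.exists_mul {h : FreeGroup (Fin 2)} (hh : rep h 1 0 ≠ 0) (K : ℤ) :
    ∃ K' N : ℤ, ∀ n : ℤ, N ≤ |n| → ∀ M, SlopeLE K M →
      SlopeLE K' (rep h * (rep (bdry ^ n) * M)) := by
  refine ⟨2 * (|rep h 0 0| + |rep h 0 1|), K + 2 * |rep h 1 1| + 1, fun n hn M ⟨hM0, hM⟩ => ?_⟩
  obtain ⟨ε, hε, hmul⟩ := rep_bdry_zpow_mul n
  have hε1 : |ε| = 1 := by rcases hε with rfl | rfl <;> simp
  set M' := rep (bdry ^ n) * M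
  have hU : |M' 1 0| = |M 1 0| := by rw [(hmul M 0).2, abs_mul, hε1, one_mul]
  have hU0 : 0 < |M 1 0| := abs_pos.2 hM0
  have hX : (2 * |rep h 1 1| + 1) * |M' 1 0| ≤ |M' 0 0| := by
    have h1 : |6 * n * M 1 0| - |M 0 0| ≤ |M 0 0 + 6 * n * M 1 0| := by
      have := abs_sub_abs_le_abs_sub (6 * n * M 1 0) (-M 0 0)
      rwa [abs_neg, sub_neg_eq_add, add_comm (6 * n * M 1 0)] at this
    rw [hU, (hmul M 0).1, abs_mul, hε1, one_mul]
    rw [abs_mul, abs_mul, abs_of_pos (by norm_num : (0 : ℤ) < 6)] at h1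
    nlinarith [abs_nonneg n]
  have e0 : (rep h * M') 0 0 = rep h 0 0 * M' 0 0 + rep h 0 1 * M' 1 0 := by
    change ((rep h).1 * M'.1) 0 0 = _
    simp [Matrix.mul_apply]
  have e1 : (rep h * M') 1 0 = rep h 1 0 * M' 0 0 + rep h 1 1 * M' 1 0 := by
    change ((rep h).1 * M'.1) 1 0 = _
    simp [Matrix.mul_apply]
  have hlow : |M' 0 0| - |rep h 1 1| * |M' 1 0| ≤ |(rep h * M') 1 0| := by
    have := abs_sub_abs_le_abs_sub (rep h 1 0 * M' 0 0) (-(rep h 1 1 * M' 1 0))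
    rw [abs_neg, sub_neg_eq_add, ← e1, abs_mul, abs_mul] at this
    nlinarith [Int.one_le_abs hh, abs_nonneg (M' 0 0)]
  have hup : |(rep h * M') 0 0| ≤ |rep h 0 0| * |M' 0 0| + |rep h 0 1| * |M' 1 0| := by
    rw [e0, ← abs_mul, ← abs_mul]
    exact abs_add_le _ _
  rw [← hU] at hU0
  have h11 := abs_nonneg (rep h 1 1)
  have hpos : |M' 0 0| + |M' 1 0| ≤ 2 * |(rep h * M') 1 0| := by nlinarith
  refine ⟨?_, ?_⟩
  · rw [← abs_pos]
    have := abs_nonneg (M' 0 0)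
    linarith
  · have h00 := abs_nonneg (rep h 0 0)
    have h01 := abs_nonneg (rep h 0 1)
    have := abs_nonneg (M' 0 0)
    nlinarith [mul_nonneg h00 this, mul_nonneg h00 hU0.le, mul_nonneg h01 this,
      mul_nonneg h01 hU0.le, mul_le_mul_of_nonneg_left hpos (add_nonneg h00 h01)]

section Double

variable {G : Type*} [Group G] (j : Bool → FreeGroup (Fin 2) →* G)

/-- Elements with a reduced alternating expression in two free groups of rank two amalgamated along
their boundaries; the Boolean records the factor of the first syllable. -/
inductive Reduced : Bool → G → Prop
  | single (s : Bool) {h : FreeGroup (Fin 2)} (hh : rep h 1 0 ≠ 0) : Reduced s (j s h)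
  | cons (s : Bool) {h : FreeGroup (Fin 2)} {w : G} (hh : rep h 1 0 ≠ 0) (hw : Reduced (!s) w) :
      Reduced s (j s h * w)

variable {j}

lemma rep_bdry_zpow_mul_ne_zero {h : FreeGroup (Fin 2)} (hh : rep h 1 0 ≠ 0) (k : ℤ) :
    rep (bdry ^ k * h) 1 0 ≠ 0 := by
  obtain ⟨ε, hε, hmul⟩ := rep_bdry_zpow_mul k
  rw [map_mul, (hmul _ _).2]
  grind

lemma rep_mul_bdry_zpow_ne_zero {h : FreeGroup (Fin 2)} (hh : rep h 1 0 ≠ 0) (k : ℤ) :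
    rep (h * bdry ^ k) 1 0 ≠ 0 := by
  intro h0
  obtain ⟨l, hl⟩ := exists_eq_bdry_zpow h0
  obtain ⟨ε, -, hmul⟩ := rep_bdry_zpow_mul (l - k)
  refine hh ?_
  rw [eq_mul_inv_of_mul_eq hl, ← zpow_neg, ← zpow_add, ← sub_eq_add_neg]
  simpa using (hmul 1 0).2

lemma Reduced.bdry_mul (hj : j true bdry = j false bdry) {s : Bool} {w : G} (hw : Reduced j s w)
    (s' : Bool) (k : ℤ) : Reduced j s (j s' (bdry ^ k) * w) := by
  have e : j s' (bdry ^ k) = j s (bdry ^ k) := by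
    cases s <;> cases s' <;> simp [hj]
  rw [e]
  cases hw with
  | single _ hh =>
    rw [← map_mul]
    exact .single s (rep_bdry_zpow_mul_ne_zero hh k)
  | cons _ hh hw =>
    rw [← mul_assoc, ← map_mul]
    exact .cons s (rep_bdry_zpow_mul_ne_zero hh k) hw

lemma Reduced.mul (hj : j true bdry = j false bdry) {s : Bool} {w : G} (hw : Reduced j s w)
    (s' : Bool) (h : FreeGroup (Fin 2)) :
    (∃ k : ℤ, j s' h * w = j true (bdry ^ k)) ∨ ∃ t, Reduced j t (j s' h * w) := by
  have e (s : Bool) (k : ℤ) : j s (bdry ^ k) = j true (bdry ^ k) := by cases s <;> simp [hj]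
  by_cases hh : rep h 1 0 = 0
  · obtain ⟨k, rfl⟩ := exists_eq_bdry_zpow hh
    exact .inr ⟨s, hw.bdry_mul hj s' k⟩
  obtain rfl | hs := eq_or_ne s s'
  · cases hw with
    | @single _ h' hh' =>
      rw [← map_mul]
      by_cases h0 : rep (h * h') 1 0 = 0
      · obtain ⟨k, hk⟩ := exists_eq_bdry_zpow h0
        exact .inl ⟨k, by rw [hk, e]⟩
      · exact .inr ⟨s, .single s h0⟩
    | @cons _ h' w' hh' hw' =>
      rw [← mul_assoc, ← map_mul]
      by_cases h0 : rep (h * h') 1 0 = 0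
      · obtain ⟨k, hk⟩ := exists_eq_bdry_zpow h0
        rw [hk]
        exact .inr ⟨!s, hw'.bdry_mul hj s k⟩
      · exact .inr ⟨s, .cons s h0 hw'⟩
  · obtain rfl : s = !s' := by cases s <;> cases s' <;> simp_all
    exact .inr ⟨s', .cons s' hh hw⟩

lemma exists_reduced (hj : j true bdry = j false bdry)
    (hgen : ⨆ s, (j s).range = ⊤) (w : G) :
    (∃ k : ℤ, w = j true (bdry ^ k)) ∨ ∃ s, Reduced j s w := by
  suffices ∀ u, ((∃ k : ℤ, u = j true (bdry ^ k)) ∨ ∃ s, Reduced j s u) →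
      ((∃ k : ℤ, w * u = j true (bdry ^ k)) ∨ ∃ s, Reduced j s (w * u)) by
    simpa using this 1 (.inl ⟨0, by simp⟩)
  have hw : w ∈ ⨆ s, (j s).range := hgen ▸ Subgroup.mem_top w
  induction hw using Subgroup.iSup_induction' with
  | h1 => simp
  | hmul x y _ _ hx hy => exact fun u hu => by simpa only [mul_assoc] using hx _ (hy u hu)
  | hp s x hx =>
    obtain ⟨h, rfl⟩ := hx
    rintro u (⟨k, rfl⟩ | ⟨t, hu⟩)
    · have e : j true (bdry ^ k) = j s (bdry ^ k) := by cases s <;> simp [hj]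
      by_cases hh : rep h 1 0 = 0
      · obtain ⟨l, rfl⟩ := exists_eq_bdry_zpow hh
        exact .inl ⟨l + k, by rw [zpow_add, map_mul]; cases s <;> simp [hj]⟩
      · rw [e, ← map_mul]
        exact .inr ⟨s, .single s (rep_mul_bdry_zpow_ne_zero hh k)⟩
    · exact hu.mul hj s h

variable {Φ : ℤ → G →* FreeGroup (Fin 2)}

lemma Reduced.exists_slopeLE (hΦ₀ : ∀ n h, Φ n (j false h) = h)
    (hΦ₁ : ∀ n h, Φ n (j true h) = bdry ^ n * h * bdry ^ (-n)) {s : Bool} {w : G}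
    (hw : Reduced j s w) : ∃ K N : ℤ, ∀ n, N ≤ n →
      SlopeLE K (rep (bdry ^ (if s then -n else 0) * Φ n w)) := by
  have hΦ (s : Bool) (n : ℤ) (h : FreeGroup (Fin 2)) :
      Φ n (j s h) = (bdry ^ (if s then -n else 0))⁻¹ * h * bdry ^ (if s then -n else 0) := by
    cases s <;> simp [hΦ₀, hΦ₁]
  induction hw with
  | @single s h hh =>
    obtain ⟨K, hK⟩ := PuncturedTorus.exists_slopeLE (rep h) hh
    refine ⟨K, 0, fun n _ => ?_⟩
    rw [hΦ, mul_assoc, mul_inv_cancel_left]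
    exact hK.mul_bdry_zpow _
  | @cons s h w hh hw ih =>
    obtain ⟨K, N, hK⟩ := ih
    obtain ⟨K', N', hK'⟩ := SlopeLE.exists_mul hh K
    refine ⟨K', max N (max N' 0), fun n hn => ?_⟩
    have := hK' (if s then -n else n) (by split_ifs <;> grind) _ (hK n (by grind))
    rw [← map_mul, ← map_mul] at this
    convert this using 2
    rw [map_mul, hΦ]
    cases s <;> simp [mul_assoc]

/-- Twisting one half of a double of a punctured torus along the boundary eventually detects every
non-trivial element. -/
theorem exists_forall_ge_ne_one (hj : j true bdry = j false bdry)
    (hgen : ⨆ s, (j s).range = ⊤) (hΦ₀ : ∀ n h, Φ n (j false h) = h)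
    (hΦ₁ : ∀ n h, Φ n (j true h) = bdry ^ n * h * bdry ^ (-n)) {w : G} (hw : w ≠ 1) :
    ∃ N, ∀ n, N ≤ n → Φ n w ≠ 1 := by
  obtain ⟨k, rfl⟩ | ⟨s, hs⟩ := exists_reduced hj hgen w
  · refine ⟨0, fun n _ h => hw ?_⟩
    rw [hΦ₁, zpow_neg, conj_eq_one_iff] at h
    rw [h, map_one]
  · obtain ⟨K, N, hK⟩ := hs.exists_slopeLE hΦ₀ hΦ₁
    refine ⟨N, fun n hn h => (hK n hn).1 ?_⟩
    obtain ⟨ε, -, hmul⟩ := rep_bdry_zpow_mul (if s then -n else 0)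
    rw [h, map_mul, (hmul _ _).2]
    simp

end Double

end PuncturedTorus

namespace SurfaceGroup

/-- The generator `aᵢ` of the surface group. -/
def a {g : ℕ} (i : Fin g) : SurfaceGroup g := PresentedGroup.of (Sum.inl i)

/-- The generator `bᵢ` of the surface group. -/
def b {g : ℕ} (i : Fin g) : SurfaceGroup g := PresentedGroup.of (Sum.inr i)

lemma prod_commutator (g : ℕ) : (List.ofFn fun i : Fin g => ⁅a i, b i⁆).prod = 1 := by
  have h := PresentedGroup.one_of_mem (rels := surfaceRel g) (Set.mem_singleton _)
  rw [map_list_prod, List.map_ofFn] at h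
  exact h

/-- A morphism from the surface group is given by images of the generators satisfying the surface
relation. -/
def lift {g : ℕ} {H : Type*} [Group H] (α β : Fin g → H)
    (h : (List.ofFn fun i => ⁅α i, β i⁆).prod = 1) : SurfaceGroup g →* H :=
  PresentedGroup.toGroup (f := Sum.elim α β) (by
    rintro _ rfl
    rw [map_list_prod, List.map_ofFn, ← h]
    congr
    funext i
    simp [commutatorElement_def])

section lift

variable {g : ℕ} {H : Type*} [Group H] {α β : Fin g → H}
  (h : (List.ofFn fun i => ⁅α i, β i⁆).prod = 1)

@[simp]
lemma lift_a (i : Fin g) : lift α β h (a i) = α i := PresentedGroup.toGroup.of _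

@[simp]
lemma lift_b (i : Fin g) : lift α β h (b i) = β i := PresentedGroup.toGroup.of _

end lift

lemma mem_of_generators {g : ℕ} (K : Subgroup (SurfaceGroup g)) (ha : ∀ i, a i ∈ K)
    (hb : ∀ i, b i ∈ K) (w : SurfaceGroup g) : w ∈ K :=
  PresentedGroup.generated_by _ K (by rintro (i | i); exacts [ha i, hb i]) w

section Cover

lemma prod_conj_eq {H : Type*} [Group H] (x y : H) (m : ℕ) :
    (List.ofFn fun p : Fin m =>
      y ^ (m - (p + 1 : ℕ)) * ⁅y, x⁆ * (y ^ (m - (p + 1 : ℕ)))⁻¹).prod = ⁅y ^ m, x⁆ := by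
  induction m with
  | zero => simp
  | succ m ih =>
    rw [List.ofFn_succ, List.prod_cons]
    simp only [Fin.val_succ, Nat.add_sub_add_right, ih, Fin.val_zero, zero_add,
      Nat.add_sub_cancel]
    simp only [commutatorElement_def, pow_succ]
    group

lemma commutator_two : ⁅a (0 : Fin 2), b (0 : Fin 2)⁆ * ⁅a (1 : Fin 2), b (1 : Fin 2)⁆ = 1 := by
  simpa [List.ofFn_succ] using prod_commutator 2

lemma commutator_one_eq : ⁅a (1 : Fin 2), b (1 : Fin 2)⁆ = ⁅b (0 : Fin 2), a (0 : Fin 2)⁆ := by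
  rw [eq_inv_of_mul_eq_one_right commutator_two, commutatorElement_inv]

/-- The morphism induced by the cyclic covering of the genus two surface of degree `n + 1`. -/
def cover (n : ℕ) : SurfaceGroup (n + 2) →* SurfaceGroup 2 :=
  lift (Fin.cons (a 0) fun p : Fin (n + 1) =>
      b 0 ^ (n + 1 - (p + 1 : ℕ)) * a 1 * (b 0 ^ (n + 1 - (p + 1 : ℕ)))⁻¹)
    (Fin.cons (b 0 ^ (n + 1)) fun p : Fin (n + 1) =>
      b 0 ^ (n + 1 - (p + 1 : ℕ)) * b 1 * (b 0 ^ (n + 1 - (p + 1 : ℕ)))⁻¹) (by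
    rw [List.ofFn_succ, List.prod_cons]
    simp only [Fin.cons_zero, Fin.cons_succ, ← conjugate_commutatorElement,
      commutator_one_eq]
    rw [prod_conj_eq, ← commutatorElement_inv, inv_mul_cancel])

/-- The permutation of `ι × G` given by a monomial matrix with entries in `G`. -/
def monomialPerm {ι G : Type*} [Group G] (σ : Equiv.Perm ι) (f : ι → G) :
    Equiv.Perm (ι × G) where
  toFun x := (σ x.1, f x.1 * x.2)
  invFun y := (σ.symm y.1, (f (σ.symm y.1))⁻¹ * y.2)
  left_inv x := by simp
  right_inv y := by simp

@[simp]
lemma monomialPerm_apply {ι G : Type*} [Group G] (σ : Equiv.Perm ι) (f : ι → G) (p : ι) (h : G) :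
    monomialPerm σ f (p, h) = (σ p, f p * h) := rfl

lemma commutator_monomialPerm_one {ι G : Type*} [Group G] (f f' : ι → G) :
    ⁅monomialPerm 1 f, monomialPerm 1 f'⁆ = monomialPerm 1 fun p => ⁅f p, f' p⁆ := by
  rw [commutatorElement_def, mul_inv_eq_iff_eq_mul, mul_inv_eq_iff_eq_mul]
  ext1 ⟨p, h⟩
  simp [commutatorElement_def, mul_assoc]

variable (n : ℕ)

/-- The partial products of the commutators of all but the first pair of generators. -/
def tailProd : Fin (n + 2) → SurfaceGroup (n + 2) :=
  Fin.partialProd fun p : Fin (n + 1) => ⁅a p.succ, b p.succ⁆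

lemma tailProd_last :
    tailProd n (Fin.last _) = ⁅b (0 : Fin (n + 2)), a (0 : Fin (n + 2))⁆ := by
  have h := prod_commutator (n + 2)
  rw [List.ofFn_succ, List.prod_cons] at h
  rw [← commutatorElement_inv, ← eq_inv_of_mul_eq_one_right h, tailProd, Fin.partialProd,
    List.take_of_length_le (by simp)]

/-- The action of `b 0` in the permutation representation induced along the cyclic covering. -/
def inducedB : Equiv.Perm (Fin (n + 1) × SurfaceGroup (n + 2)) :=
  monomialPerm (finRotate (n + 1)) (fun p => if p = Fin.last n then b 0 else 1)

/-- The action of `a 0` in the permutation representation induced along the cyclic covering. -/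
def inducedA : Equiv.Perm (Fin (n + 1) × SurfaceGroup (n + 2)) :=
  monomialPerm 1 fun p => (tailProd n p.succ)⁻¹ * (b 0 * a 0 * (b 0)⁻¹)

lemma inducedB_last (h : SurfaceGroup (n + 2)) :
    inducedB n (Fin.last n, h) = (0, b 0 * h) := by
  simp [inducedB]

lemma inducedB_castSucc (p : Fin n) (h : SurfaceGroup (n + 2)) :
    inducedB n (p.castSucc, h) = (p.succ, h) := by
  simp [inducedB, Fin.castSucc_ne_last]

lemma inducedB_pow (p : Fin (n + 1)) (h : SurfaceGroup (n + 2)) :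
    (inducedB n ^ (n + 1 - (p + 1 : ℕ))) (p, h) = (Fin.last n, h) := by
  induction p using Fin.reverseInduction with
  | last => simp
  | cast p ih =>
    have e : n + 1 - ((p.castSucc : ℕ) + 1) = n + 1 - ((p.succ : ℕ) + 1) + 1 := by
      simp
      omega
    rw [e, pow_succ, Equiv.Perm.mul_apply, inducedB_castSucc, ih]

lemma inducedA_last (h : SurfaceGroup (n + 2)) :
    inducedA n (Fin.last n, h) = (Fin.last n, a 0 * h) := by
  simp [inducedA, tailProd_last, commutatorElement_def, mul_assoc]

lemma induced_relation :
    ⁅inducedA n, inducedB n⁆ * monomialPerm 1 (fun p => ⁅a p.succ, b p.succ⁆) = 1 := by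
  suffices monomialPerm 1 (fun p => ⁅a p.succ, b p.succ⁆) * inducedA n * inducedB n =
      inducedB n * inducedA n by
    rw [← eq_mul_inv_iff_mul_eq, ← eq_mul_inv_iff_mul_eq, ← commutatorElement_def] at this
    rw [this, ← commutatorElement_inv (inducedA n), mul_inv_cancel]
  have hq (q : Fin (n + 1)) : ⁅a q.succ, b q.succ⁆ * (tailProd n q.succ)⁻¹ =
      (tailProd n q.castSucc)⁻¹ := by
    rw [tailProd, Fin.partialProd_succ]
    group
  ext1 ⟨p, h⟩
  induction p using Fin.lastCases with
  | last =>
    simp only [Equiv.Perm.mul_apply, inducedB_last, inducedA_last]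
    simp only [inducedA, monomialPerm_apply, ← mul_assoc, Equiv.Perm.one_apply, hq]
    simp [tailProd]
  | cast p =>
    simp only [Equiv.Perm.mul_apply, inducedB_castSucc]
    simp only [inducedA, monomialPerm_apply, ← mul_assoc, hq, Equiv.Perm.one_apply,
      inducedB_castSucc, Fin.succ_castSucc]

/-- The permutation representation of the genus two surface group induced from the regular
representation along the cyclic covering. -/
def induced : SurfaceGroup 2 →* Equiv.Perm (Fin (n + 1) × SurfaceGroup (n + 2)) :=
  lift ![inducedA n, monomialPerm 1 fun p => a p.succ]
    ![inducedB n, monomialPerm 1 fun p => b p.succ] (by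
      simpa [List.ofFn_succ, commutator_monomialPerm_one] using induced_relation n)

lemma induced_cover_apply (w h : SurfaceGroup (n + 2)) :
    induced n (cover n w) (Fin.last n, h) = (Fin.last n, w * h) := by
  let K : Subgroup (SurfaceGroup (n + 2)) :=
    { carrier := {w | ∀ h, induced n (cover n w) (Fin.last n, h) = (Fin.last n, w * h)}
      one_mem' := by simp
      mul_mem' := fun {x y} hx hy h => by
        rw [map_mul, map_mul, Equiv.Perm.mul_apply, hy, hx, mul_assoc]
      inv_mem' := fun {x} hx h => by
        rw [map_inv, map_inv, Equiv.Perm.inv_eq_iff_eq, hx, mul_inv_cancel_left] }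
  have hinv (p : Fin (n + 1)) (h : SurfaceGroup (n + 2)) :
      (inducedB n ^ (n + 1 - (p + 1 : ℕ)))⁻¹ (Fin.last n, h) = (p, h) := by
    rw [Equiv.Perm.inv_eq_iff_eq, inducedB_pow]
  refine mem_of_generators K (fun i h => ?_) (fun i h => ?_) w h
  · cases i using Fin.cases with
    | zero => simp [cover, induced, inducedA_last]
    | succ p =>
      simp only [cover, induced, lift_a, lift_b, Fin.cons_succ, map_mul, map_inv, map_pow,
        Matrix.cons_val_zero, Matrix.cons_val_one, Equiv.Perm.mul_apply, hinv]
      simp only [monomialPerm_apply, Equiv.Perm.one_apply, inducedB_pow]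
  · cases i using Fin.cases with
    | zero =>
      have := inducedB_pow n 0 (b 0 * h)
      simp only [Fin.val_zero, zero_add, Nat.add_sub_cancel] at this
      simp [cover, induced, pow_succ, inducedB_last, this]
    | succ p =>
      simp only [cover, induced, lift_b, Fin.cons_succ, map_mul, map_inv, map_pow,
        Matrix.cons_val_zero, Matrix.cons_val_one, Equiv.Perm.mul_apply, hinv]
      simp only [monomialPerm_apply, Equiv.Perm.one_apply, inducedB_pow]

lemma cover_injective : Function.Injective (cover n) := by
  rw [injective_iff_map_eq_one]
  intro w hw
  simpa [hw, eq_comm] using induced_cover_apply n w 1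

end Cover

section GenusTwo

open PuncturedTorus

/-- The inclusions of the two one-holed tori into the genus two surface group; the second one
reverses the orientation. -/
def half (s : Bool) : FreeGroup (Fin 2) →* SurfaceGroup 2 :=
  FreeGroup.lift (if s then ![b 1, a 1] else ![a 0, b 0])

lemma half_bdry : half true bdry = half false bdry := by
  have h := congr_arg (·⁻¹) commutator_one_eq
  simp only [commutatorElement_inv] at h
  simpa [half, bdry, commutatorElement_def] using h

lemma iSup_range_half : ⨆ s, (half s).range = ⊤ := by
  rw [eq_top_iff]
  intro w _
  have hm (s : Bool) (h : FreeGroup (Fin 2)) : half s h ∈ ⨆ s, (half s).range :=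
    Subgroup.mem_iSup_of_mem s ⟨h, rfl⟩
  refine mem_of_generators _ (fun i => ?_) (fun i => ?_) w
  · fin_cases i
    · simpa [half] using hm false (FreeGroup.of 0)
    · simpa [half] using hm true (FreeGroup.of 1)
  · fin_cases i
    · simpa [half] using hm false (FreeGroup.of 1)
    · simpa [half] using hm true (FreeGroup.of 0)

/-- The folding of the genus two surface onto a one-holed torus, precomposed with the `n`-th power
of the Dehn twist along the boundary. -/
def twistedFold (n : ℤ) : SurfaceGroup 2 →* FreeGroup (Fin 2) :=
  lift ![FreeGroup.of 0, bdry ^ n * FreeGroup.of 1 * (bdry ^ n)⁻¹]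
    ![FreeGroup.of 1, bdry ^ n * FreeGroup.of 0 * (bdry ^ n)⁻¹] (by
      have e : ⁅FreeGroup.of (1 : Fin 2), FreeGroup.of 0⁆ = bdry⁻¹ := by
        simp [bdry, commutatorElement_def, mul_assoc]
      have e' : ⁅FreeGroup.of (0 : Fin 2), FreeGroup.of 1⁆ = bdry := rfl
      simp only [List.ofFn_succ, List.ofFn_zero, Matrix.cons_val_zero, Matrix.cons_val_succ,
        ← conjugate_commutatorElement, e, e', List.prod_cons, List.prod_nil]
      group)

lemma twistedFold_half_false (n : ℤ) (h : FreeGroup (Fin 2)) :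
    twistedFold n (half false h) = h := by
  suffices (twistedFold n).comp (half false) = MonoidHom.id _ from DFunLike.congr_fun this h
  ext i
  fin_cases i <;> simp [twistedFold, half]

lemma twistedFold_half_true (n : ℤ) (h : FreeGroup (Fin 2)) :
    twistedFold n (half true h) = bdry ^ n * h * bdry ^ (-n) := by
  suffices (twistedFold n).comp (half true) = (MulAut.conj (bdry ^ n)).toMonoidHom by
    rw [zpow_neg]
    exact DFunLike.congr_fun this h
  ext i
  fin_cases i <;> simp [twistedFold, half, -map_zpow]

theorem exists_forall_ge_twistedFold_ne_one {w : SurfaceGroup 2} (hw : w ≠ 1) :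
    ∃ N, ∀ n, N ≤ n → twistedFold n w ≠ 1 :=
  exists_forall_ge_ne_one half_bdry iSup_range_half twistedFold_half_false twistedFold_half_true hw

end GenusTwo

end SurfaceGroup

/-- Theorem 2.27 of the paper (G. Baumslag): for `g ≥ 2`, the surface group `π₁Σ_g` is
fully residually free: for every finite set of non-trivial elements there is a morphism
to the free group of rank 2 killing none of them. -/
theorem surfaceGroup_fully_residually_free (g : ℕ) (hg : 2 ≤ g)
    (S : Finset (SurfaceGroup g)) (hS : (1 : SurfaceGroup g) ∉ S) :
    ∃ φ : SurfaceGroup g →* FreeGroup (Fin 2), ∀ s ∈ S, φ s ≠ 1 := by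
  obtain ⟨n, rfl⟩ := Nat.exists_eq_add_of_le' hg
  have h (s : SurfaceGroup (n + 2)) (hs : s ∈ S) :
      ∀ᶠ k : ℤ in Filter.atTop, SurfaceGroup.twistedFold k (SurfaceGroup.cover n s) ≠ 1 := by
    refine Filter.eventually_atTop.2 (SurfaceGroup.exists_forall_ge_twistedFold_ne_one ?_)
    rw [Ne, map_eq_one_iff _ (SurfaceGroup.cover_injective n)]
    exact ne_of_mem_of_not_mem hs hS
  obtain ⟨k, hk⟩ := ((Filter.eventually_all_finset S).2 h).exists
  exact ⟨(SurfaceGroup.twistedFold k).comp (SurfaceGroup.cover n), hk⟩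
end

section
/- Let g ≥ 2, let ι be a type, and let φ : π₁Σ_g →* FreeGroup ι be a group homomorphism whose image is non-abelian (i.e. there exist u, v in the range of φ with u * v ≠ v * u). Then for every n : ℕ there exists a group automorphism α of π₁Σ_g such that for every w ∈ Bₙ with w ≠ 1, one has φ (α w) ≠ 1; that is, the kernel of φ ∘ α meets Bₙ only in the identity. (Corollary 2.31 of the paper, 'enfinlibre'.) -/
/-- The standard generators `aᵢ, bᵢ, aᵢ⁻¹, bᵢ⁻¹` of the surface group. -/
def surfaceGens (g : ℕ) : Set (SurfaceGroup g) :=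
  {x | ∃ i : Fin g,
    x = PresentedGroup.of (Sum.inl i) ∨ x = PresentedGroup.of (Sum.inr i) ∨
    x = (PresentedGroup.of (Sum.inl i) : SurfaceGroup g)⁻¹ ∨
    x = (PresentedGroup.of (Sum.inr i) : SurfaceGroup g)⁻¹}

/-- The ball `Bₙ` of radius `n` in the surface group for the Cayley metric associated to
the standard generators: elements expressible as products of at most `n` generators or
inverses of generators. -/
def cayleyBall (g n : ℕ) : Set (SurfaceGroup g) :=
  {x | ∃ l : List (SurfaceGroup g),
      l.length ≤ n ∧ (∀ y ∈ l, y ∈ surfaceGens g) ∧ l.prod = x}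

section Representations

open Polynomial Matrix

theorem coeff_matrix_list_prod {K : Type*} [Field K] (d : ℕ)
    (L : List (Matrix (Fin 2) (Fin 2) K[X]))
    (hL : ∀ M ∈ L, ∀ i j, (M i j).natDegree ≤ d) :
    (L.prod).map (fun p => p.coeff (L.length * d)) =
      (L.map fun M => M.map fun p => p.coeff d).prod := by
  have hdeg : ∀ q ∈ L.map (matPolyEquiv : Matrix (Fin 2) (Fin 2) K[X] ≃ₐ[K] _),
      natDegree q ≤ d := by
    intro q hq
    obtain ⟨M, hM, rfl⟩ := List.mem_map.1 hq
    rw [natDegree_le_iff_coeff_eq_zero]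
    intro N hN
    ext i j
    rw [matPolyEquiv_coeff_apply]
    exact coeff_eq_zero_of_natDegree_lt ((hL M hM i j).trans_lt hN)
  have h := coeff_list_prod_of_natDegree_le _ d hdeg
  rw [← map_list_prod, List.length_map, List.map_map] at h
  convert h using 1
  · ext i j
    rw [matPolyEquiv_coeff_apply, Matrix.map_apply]
  · congr 1
    refine List.map_congr_left fun M _ => ?_
    ext i j
    simp [matPolyEquiv_coeff_apply]

/-- The rank-one matrix with image spanned by `(1, s)` and kernel spanned by `(1, t)`. -/
def rankOne {K : Type*} [Field K] (s t : K) : Matrix (Fin 2) (Fin 2) K :=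
  !![-t, 1; -(s * t), s]

theorem rankOne_mul {K : Type*} [Field K] (s t s' t' : K) :
    rankOne s t * rankOne s' t' = (s' - t) • rankOne s t' := by
  ext i j
  fin_cases i <;> fin_cases j <;> simp [rankOne, Matrix.mul_apply] <;> ring

/-- The matrix with eigenvalue `q` on `(1, s)` and `q⁻¹` on `(1, t)`. -/
def hyperbolic {K : Type*} [Field K] (q s t : K) : Matrix (Fin 2) (Fin 2) K :=
  (q * (s - t)⁻¹) • rankOne s t - (q⁻¹ * (s - t)⁻¹) • rankOne t s

theorem hyperbolic_mul_hyperbolic {K : Type*} [Field K] {q s t : K} (hq : q ≠ 0) (h : s ≠ t) :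
    hyperbolic q s t * hyperbolic q t s = 1 := by
  have : s - t ≠ 0 := sub_ne_zero.2 h
  have : t - s ≠ 0 := sub_ne_zero.2 h.symm
  have e : (t - s)⁻¹ = -(s - t)⁻¹ := by rw [← neg_sub, inv_neg]
  ext i j
  fin_cases i <;> fin_cases j <;> simp [hyperbolic, rankOne, Matrix.mul_apply, e] <;>
    field_simp <;> ring

/-- The homomorphism from a free group to `GL₂` sending generators to hyperbolic matrices with
prescribed fixed points and multiplier. -/
def schottky {α K : Type*} [Field K] (t : α × Bool → K) (ht : Function.Injective t)
    (q : K) (hq : q ≠ 0) : FreeGroup α →* GL (Fin 2) K :=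
  FreeGroup.lift fun i =>
    ⟨hyperbolic q (t (i, true)) (t (i, false)), hyperbolic q (t (i, false)) (t (i, true)),
      hyperbolic_mul_hyperbolic hq (ht.ne (by simp)),
      hyperbolic_mul_hyperbolic hq (ht.ne (by simp))⟩

theorem schottky_mk {α K : Type*} [Field K] (t : α × Bool → K) (ht : Function.Injective t)
    (q : K) (hq : q ≠ 0) (L : List (α × Bool)) :
    (schottky t ht q hq (FreeGroup.mk L) : Matrix (Fin 2) (Fin 2) K) =
      (L.map fun x => hyperbolic q (t x) (t (x.1, !x.2))).prod := by
  induction L with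
  | nil => rw [← FreeGroup.one_eq_mk, map_one]; rfl
  | cons x L ih =>
    rw [← List.singleton_append, ← FreeGroup.mul_mk, map_mul, Units.val_mul, ih,
      List.singleton_append, List.map_cons, List.prod_cons]
    congr 1
    obtain ⟨i, b⟩ := x
    cases b
    · have e : (FreeGroup.mk [(i, false)] : FreeGroup α) = (FreeGroup.of i)⁻¹ := rfl
      rw [e, map_inv, schottky, FreeGroup.lift_apply_of]
      rfl
    · have e : (FreeGroup.mk [(i, true)] : FreeGroup α) = FreeGroup.of i := rfl
      rw [e, schottky, FreeGroup.lift_apply_of]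
      rfl

theorem rankOne_prod {α K : Type*} [Field K] (t : α × Bool → K) (ht : Function.Injective t)
    (x : α × Bool) (L : List (α × Bool)) (hL : FreeGroup.IsReduced (x :: L)) :
    ∃ c y : K, c ≠ 0 ∧
      ((x :: L).map fun x => (t x - t (x.1, !x.2))⁻¹ • rankOne (t x) (t (x.1, !x.2))).prod =
        c • rankOne (t x) y := by
  have hne : ∀ x, t x - t (x.1, !x.2) ≠ 0 := fun x =>
    sub_ne_zero.2 (ht.ne fun h => by simpa using congrArg Prod.snd h)
  induction L generalizing x with
  | nil => exact ⟨_, t (x.1, !x.2), inv_ne_zero (hne x), by simp⟩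
  | cons z L ih =>
    rw [FreeGroup.isReduced_cons_cons] at hL
    obtain ⟨c, y, hc, h⟩ := ih z hL.2
    refine ⟨(t x - t (x.1, !x.2))⁻¹ * c * (t z - t (x.1, !x.2)), y, ?_, ?_⟩
    · refine mul_ne_zero (mul_ne_zero (inv_ne_zero (hne x)) hc) (sub_ne_zero.2 (ht.ne ?_))
      rintro rfl
      simpa using hL.1 rfl
    · rw [List.map_cons, List.prod_cons, h, smul_mul_smul_comm, rankOne_mul, smul_smul]

/-- For a nontrivial element of a free group, all but finitely many Schottky homomorphisms do not
kill it. -/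
theorem exists_schottky_ne_one {α : Type*} {k : Type*} [Field k] (t : α × Bool → k)
    (ht : Function.Injective t) (w : FreeGroup α) (hw : w ≠ 1) :
    ∃ p : k[X], p ≠ 0 ∧ ∀ {K : Type*} [Field K] [Algebra k K] (q : K) (hq : q ≠ 0),
      aeval q p ≠ 0 →
        schottky (fun x => algebraMap k K (t x)) ((algebraMap k K).injective.comp ht) q hq w
          ≠ 1 := by
  classical
  let E : α × Bool → Matrix (Fin 2) (Fin 2) k := fun x =>
    (t x - t (x.1, !x.2))⁻¹ • rankOne (t x) (t (x.1, !x.2))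
  let N : α × Bool → Matrix (Fin 2) (Fin 2) k[X] := fun x =>
    Matrix.of fun i j => C (E x i j) * X ^ 2 + C (E (x.1, !x.2) i j)
  let L := w.toWord
  have hL : FreeGroup.IsReduced L := FreeGroup.isReduced_toWord
  have hLn : L ≠ [] := by simpa [L] using hw
  have hpos : 0 < L.length := List.length_pos_iff.2 hLn
  have hcoef := coeff_matrix_list_prod 2 (L.map N) (by
    intro M hM i j
    obtain ⟨x, -, rfl⟩ := List.mem_map.1 hM
    simp only [N, Matrix.of_apply]
    compute_degree)
  have hE : ((L.map N).map fun M => M.map fun p => p.coeff 2).prod = (L.map E).prod := by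
    rw [List.map_map]
    congr 1
    refine List.map_congr_left fun x _ => ?_
    ext i j
    simp [N]
  obtain ⟨i, j, hij⟩ : ∃ i j, ((L.map N).prod - (X ^ L.length : k[X]) • 1) i j ≠ 0 := by
    by_contra! h
    have h1 : (L.map N).prod = (X ^ L.length : k[X]) • 1 := by
      ext1 i j
      exact sub_eq_zero.1 (h i j)
    rw [hE, h1] at hcoef
    obtain ⟨x, L', hx⟩ := List.exists_cons_of_ne_nil hLn
    rw [hx] at hL
    obtain ⟨c, y, hc, hp⟩ := rankOne_prod t ht x L' hL
    rw [← hx] at hp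
    change (L.map E).prod = _ at hp
    rw [hp] at hcoef
    have := congrFun (congrFun hcoef 0) 1
    simp [rankOne] at this
    exact hc this.symm
  refine ⟨_, hij, ?_⟩
  intro K _ _ q hq hp h1
  apply hp
  have hw' : w = FreeGroup.mk L := FreeGroup.mk_toWord.symm
  have h2 := congrArg Units.val h1
  rw [hw', schottky_mk, Units.val_one] at h2
  have hmap : ∀ x, (aeval q : k[X] →ₐ[k] K).mapMatrix (N x) =
      q • hyperbolic q (algebraMap k K (t x)) (algebraMap k K (t (x.1, !x.2))) := by
    intro x
    have e : ∀ a b : k, (a - b)⁻¹ = -(b - a)⁻¹ := fun a b => by rw [← neg_sub, inv_neg]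
    ext i j
    fin_cases i <;> fin_cases j <;>
      simp [N, E, hyperbolic, rankOne, e (t (x.1, !x.2)) (t x)] <;> field_simp <;> ring
  have hmap' : ∀ l : List (α × Bool), (aeval q : k[X] →ₐ[k] K).mapMatrix (l.map N).prod =
      q ^ l.length • (l.map fun x => hyperbolic q (algebraMap k K (t x))
        (algebraMap k K (t (x.1, !x.2)))).prod := by
    intro l
    induction l with
    | nil => simp
    | cons x l ih =>
      rw [List.map_cons, List.prod_cons, map_mul, ih, hmap, smul_mul_smul_comm, List.map_cons,
        List.prod_cons, List.length_cons, pow_succ']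
  have h3 := hmap' L
  rw [h2] at h3
  have h4 := congrFun (congrFun h3 i) j
  simp only [AlgHom.mapMatrix_apply, Matrix.map_apply] at h4
  rw [Matrix.sub_apply, map_sub, h4]
  by_cases hh : i = j <;> simp [hh]

theorem exists_finite_hom_ne_one (w : FreeGroup Bool) (hw : w ≠ 1) :
    ∃ (G : Type) (_ : Group G) (_ : Finite G) (ψ : FreeGroup Bool →* G), ψ w ≠ 1 := by
  let t : Bool × Bool → ZMod 5 := fun x => cond x.1 (cond x.2 0 1) (cond x.2 2 3)
  have ht : Function.Injective t := by
    simp only [t]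
    decide
  have : Fact (Nat.Prime 5) := ⟨by norm_num⟩
  obtain ⟨p, hp, h⟩ := exists_schottky_ne_one t ht w hw
  let n := p.natDegree + 1
  have hn : n ≠ 0 := by simp [n]
  have : Fintype (GaloisField 5 n) := Fintype.ofFinite _
  let P : (GaloisField 5 n)[X] := (p * X).map (algebraMap (ZMod 5) (GaloisField 5 n))
  have hP : P ≠ 0 := by
    rw [Polynomial.map_ne_zero_iff (algebraMap (ZMod 5) (GaloisField 5 n)).injective]
    exact mul_ne_zero hp X_ne_zero
  obtain ⟨q, hq⟩ : ∃ q, P.eval q ≠ 0 := by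
    refine Polynomial.exists_eval_ne_zero_of_natDegree_lt_card P hP ?_
    rw [Cardinal.mk_fintype, ← Nat.card_eq_fintype_card, GaloisField.card 5 n hn]
    have h1 : P.natDegree ≤ n := by
      simp only [P, natDegree_map]
      exact natDegree_mul_le.trans (by simp [n])
    exact_mod_cast h1.trans_lt (Nat.lt_pow_self (by norm_num))
  have hq' : aeval q p * q ≠ 0 := by
    simpa [P, eval_map_algebraMap] using hq
  exact ⟨GL (Fin 2) (GaloisField 5 n), inferInstance, inferInstance, _,
    h q (right_ne_zero_of_mul hq') (left_ne_zero_of_mul hq')⟩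

theorem injective_of_surjective_freeGroup_bool (f : FreeGroup Bool →* FreeGroup Bool)
    (hf : Function.Surjective f) : Function.Injective f := by
  rw [injective_iff_map_eq_one]
  intro w hw
  by_contra hne
  obtain ⟨G, _, _, ψ, hψ⟩ := exists_finite_hom_ne_one w hne
  have : Finite (FreeGroup Bool →* G) := Finite.of_equiv _ FreeGroup.lift
  have hinj : Function.Injective fun χ : FreeGroup Bool →* G => χ.comp f := fun χ χ' h =>
    MonoidHom.cancel_right hf |>.1 h
  obtain ⟨χ, hχ⟩ := Finite.surjective_of_injective hinj ψ
  exact hψ (by rw [← hχ]; simp [hw])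

/-- Two non-commuting elements of a free group freely generate a free subgroup. -/
theorem injective_of_not_commute {ι : Type*} (f : FreeGroup Bool →* FreeGroup ι)
    (h : ¬ Commute (f (FreeGroup.of true)) (f (FreeGroup.of false))) :
    Function.Injective f := by
  classical
  let e := IsFreeGroup.toFreeGroup f.range
  set X := IsFreeGroup.Generators f.range
  let F : FreeGroup Bool →* FreeGroup X := e.toMonoidHom.comp f.rangeRestrict
  have hF : Function.Surjective F := e.surjective.comp f.rangeRestrict_surjective
  have hFnc : ¬ Commute (F (FreeGroup.of true)) (F (FreeGroup.of false)) := by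
    intro hc
    apply h
    have h1 : Commute (f.rangeRestrict (FreeGroup.of true))
        (f.rangeRestrict (FreeGroup.of false)) := by
      have := hc.map e.symm
      simpa [F] using this
    exact h1.map f.range.subtype
  let Z := Multiplicative (ZMod 2)
  have hinj : Function.Injective fun χ : FreeGroup X →* Z => χ.comp F := fun χ χ' h =>
    MonoidHom.cancel_right hF |>.1 h
  let T : (X → Z) → (Bool → Z) := fun a => FreeGroup.lift.symm ((FreeGroup.lift a).comp F)
  have hT : Function.Injective T := fun a b hab =>
    FreeGroup.lift.injective (hinj (FreeGroup.lift.symm.injective hab))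
  have : Finite (X → Z) := Finite.of_injective T hT
  have : Finite X := by
    refine Finite.of_injective (fun x : X => (Pi.mulSingle x (Multiplicative.ofAdd 1) : X → Z)) ?_
    intro x y hxy
    by_contra hne
    have := congrFun hxy x
    simp only [Pi.mulSingle_eq_same, Pi.mulSingle_eq_of_ne hne] at this
    exact absurd this (by decide)
  have := Fintype.ofFinite X
  have hcard : Fintype.card X ≤ 2 := by
    have h1 := Fintype.card_le_of_injective T hT
    have hZ : Fintype.card Z = 2 := rfl
    rw [Fintype.card_fun, Fintype.card_fun, hZ, Fintype.card_bool] at h1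
    exact (Nat.pow_le_pow_iff_right (by norm_num)).1 h1
  have hcard2 : Fintype.card X = 2 := by
    by_contra hne
    have : Subsingleton X := Fintype.card_le_one_iff_subsingleton.1 (by omega)
    apply hFnc
    have hcomm : ∀ u v : FreeGroup X, Commute u v := by
      intro u v
      induction u using FreeGroup.induction_on with
      | C1 => exact Commute.one_left _
      | of x =>
        induction v using FreeGroup.induction_on with
        | C1 => exact Commute.one_right _
        | of y => rw [Subsingleton.elim x y]
        | inv_of y h => exact h.inv_right
        | mul a b ha hb => exact ha.mul_right hb
      | inv_of x h => exact h.inv_left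
      | mul a b ha hb => exact ha.mul_left hb
    exact hcomm _ _
  let ε : X ≃ Bool := Fintype.equivOfCardEq (by rw [hcard2, Fintype.card_bool])
  have hH := injective_of_surjective_freeGroup_bool
    ((FreeGroup.freeGroupCongr ε).toMonoidHom.comp F)
    ((FreeGroup.freeGroupCongr ε).surjective.comp hF)
  have hFi : Function.Injective F := Function.Injective.of_comp hH
  exact Function.Injective.of_comp (f := fun x => e x)
    (g := f.rangeRestrict) hFi |> fun h => f.rangeRestrict_injective_iff.1 h

theorem det_schottky {α K : Type*} [Field K] (t : α × Bool → K) (ht : Function.Injective t)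
    (q : K) (hq : q ≠ 0) (w : FreeGroup α) : (schottky t ht q hq w).val.det = 1 := by
  classical
  rw [← FreeGroup.mk_toWord (x := w), schottky_mk]
  induction w.toWord with
  | nil => simp
  | cons x L ih =>
    rw [List.map_cons, List.prod_cons, Matrix.det_mul, ih, mul_one]
    have h : t x - t (x.1, !x.2) ≠ 0 :=
      sub_ne_zero.2 (ht.ne fun h => by simpa using congrArg Prod.snd h)
    have e : (t (x.1, !x.2) - t x)⁻¹ = -(t x - t (x.1, !x.2))⁻¹ := by rw [← neg_sub, inv_neg]
    simp only [hyperbolic, rankOne, Matrix.det_fin_two]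
    simp
    field_simp
    ring

/-- Free groups are linear of degree two over an algebraically closed field of
characteristic two. -/
theorem exists_faithful_rep.{u} (ι : Type u) :
    ∃ (K : Type u) (_ : Field K) (_ : CharP K 2) (_ : IsAlgClosed K)
      (ρ : FreeGroup ι →* Matrix (Fin 2) (Fin 2) K),
      Function.Injective ρ ∧ ∀ w, (ρ w).det = 1 := by
  let k := FractionRing (MvPolynomial (ι × Bool) (ZMod 2))
  let K := AlgebraicClosure (FractionRing k[X])
  let t : ι × Bool → k := fun x =>
    algebraMap (MvPolynomial (ι × Bool) (ZMod 2)) k (MvPolynomial.X x)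
  have ht : Function.Injective t :=
    (IsFractionRing.injective (MvPolynomial (ι × Bool) (ZMod 2)) k).comp MvPolynomial.X_injective
  have hinj : Function.Injective (algebraMap k[X] K) := by
    rw [IsScalarTower.algebraMap_eq k[X] (FractionRing k[X]) K]
    exact (algebraMap (FractionRing k[X]) K).injective.comp
      (IsFractionRing.injective k[X] (FractionRing k[X]))
  let q : K := algebraMap k[X] K X
  have hq : q ≠ 0 := by
    rw [Ne, ← map_zero (algebraMap k[X] K), hinj.eq_iff]
    exact X_ne_zero
  have hq' : ∀ p : k[X], p ≠ 0 → aeval q p ≠ 0 := by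
    intro p hp
    rw [Polynomial.aeval_algebraMap_apply, Polynomial.aeval_X_left_apply, Ne,
      ← map_zero (algebraMap k[X] K), hinj.eq_iff]
    exact hp
  have : CharP k 2 := charP_of_injective_algebraMap (algebraMap (ZMod 2) k).injective 2
  have : CharP K 2 := charP_of_injective_algebraMap (algebraMap k K).injective 2
  refine ⟨K, inferInstance, inferInstance, inferInstance, (Units.coeHom _).comp
    (schottky (fun x => algebraMap k K (t x)) ((algebraMap k K).injective.comp ht) q hq), ?_,
    fun w => det_schottky _ _ q hq w⟩
  refine Units.val_injective.comp ((injective_iff_map_eq_one _).2 fun w hw => ?_)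
  by_contra hne
  obtain ⟨p, hp, h⟩ := exists_schottky_ne_one t ht w hne
  exact h q hq (hq' p hp) hw

theorem exists_conj_rep {G K : Type*} [Group G] [Field K] (ρ : G →* Matrix (Fin 2) (Fin 2) K)
    (hρ : Function.Injective ρ) (hdet : ∀ w, (ρ w).det = 1) {A B : Matrix (Fin 2) (Fin 2) K}
    (hBA : B * A = 1) :
    ∃ ρ' : G →* Matrix (Fin 2) (Fin 2) K, Function.Injective ρ' ∧ (∀ w, (ρ' w).det = 1) ∧
      ∀ w, ρ' w = A * ρ w * B := by
  have hAB : A * B = 1 := mul_eq_one_comm.1 hBA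
  refine ⟨⟨⟨fun w => A * ρ w * B, by simp [hAB]⟩, fun v w => ?_⟩, ?_, ?_, fun w => rfl⟩
  · have : A * ρ v * B * (A * ρ w * B) = A * ρ v * (B * A) * ρ w * B := by noncomm_ring
    change A * ρ (v * w) * B = A * ρ v * B * (A * ρ w * B)
    rw [this, hBA, map_mul, mul_one, ← mul_assoc A]
  · intro v w h
    apply hρ
    have h' : A * ρ v * B = A * ρ w * B := h
    have := congrArg (fun M => B * M * A) h'
    have e : ∀ M : Matrix (Fin 2) (Fin 2) K, B * (A * M * B) * A = (B * A) * M * (B * A) := by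
      intro M; noncomm_ring
    simpa [e, hBA] using this
  · intro w
    change (A * ρ w * B).det = 1
    rw [Matrix.det_mul, Matrix.det_mul, hdet, mul_one, ← Matrix.det_mul, hAB, Matrix.det_one]

theorem sq_eq_one_of_unipotent {K : Type*} [Field K] [CharP K 2] {M : Matrix (Fin 2) (Fin 2) K}
    (hdet : M.det = 1) (hM : M 0 1 = 0 ∨ M 1 0 = 0) (h : M 0 0 = M 1 1) : M ^ 2 = 1 := by
  have h2 : (2 : K) = 0 := CharTwo.two_eq_zero
  rw [Matrix.det_fin_two, ← h] at hdet
  have h1 : M 0 0 * M 0 0 = 1 := by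
    rcases hM with hM | hM <;> simpa [hM] using hdet
  ext i j
  rcases hM with hM | hM <;> fin_cases i <;> fin_cases j <;>
    simp [pow_two, Matrix.mul_apply, hM, ← h, h1]
  · linear_combination M 0 0 * M 1 0 * h2
  · linear_combination M 0 0 * M 0 1 * h2

theorem FreeGroup.eq_one_of_map_sq {ι R : Type*} [Monoid R] {ρ : FreeGroup ι →* R}
    (hρ : Function.Injective ρ) {w : FreeGroup ι} (h : ρ w ^ 2 = 1) : w = 1 := by
  have : ρ (w ^ 2) = ρ 1 := by rw [_root_.map_pow, _root_.map_one, h]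
  exact (pow_eq_one_iff_left two_ne_zero).1 (hρ this)

/-- Any nontrivial element of a free group is diagonal in some faithful representation of degree
two in characteristic two. -/
theorem exists_diagonal_rep.{u} {ι : Type u} (z : FreeGroup ι) (hz : z ≠ 1) :
    ∃ (K : Type u) (_ : Field K) (_ : CharP K 2) (ρ : FreeGroup ι →* Matrix (Fin 2) (Fin 2) K),
      Function.Injective ρ ∧ (∀ w, (ρ w).det = 1) ∧ ρ z 0 1 = 0 ∧ ρ z 1 0 = 0 := by
  obtain ⟨K, _, _, _, ρ, hρ, hdet⟩ := exists_faithful_rep ι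
  have key : ∀ ρ : FreeGroup ι →* Matrix (Fin 2) (Fin 2) K, Function.Injective ρ →
      (∀ w, (ρ w).det = 1) → (ρ z 0 1 = 0 ∨ ρ z 1 0 = 0) → ρ z 0 0 ≠ ρ z 1 1 :=
    fun ρ hρ hdet h h' => hz (FreeGroup.eq_one_of_map_sq hρ
      (sq_eq_one_of_unipotent (hdet z) h h'))
  have upper : ∀ x : K, (!![1, x; 0, 1] : Matrix (Fin 2) (Fin 2) K) * !![1, -x; 0, 1] = 1 := by
    intro x
    ext i j; fin_cases i <;> fin_cases j <;> simp [Matrix.mul_apply]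
  have lower : ∀ x : K, (!![1, 0; x, 1] : Matrix (Fin 2) (Fin 2) K) * !![1, 0; -x, 1] = 1 := by
    intro x
    ext i j; fin_cases i <;> fin_cases j <;> simp [Matrix.mul_apply]
  refine ⟨K, inferInstance, inferInstance, ?_⟩
  by_cases hc : ρ z 1 0 = 0
  · have hne := sub_ne_zero.2 (key ρ hρ hdet (Or.inr hc))
    obtain ⟨ρ', h1, h2, h3⟩ := exists_conj_rep ρ hρ hdet
      (upper (-ρ z 0 1 / (ρ z 0 0 - ρ z 1 1)))
    refine ⟨ρ', h1, h2, ?_, ?_⟩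
    · rw [h3]
      simp only [Matrix.mul_apply, Fin.sum_univ_two, of_apply, cons_val_zero, cons_val_one, hc,
        cons_val', cons_val_fin_one]
      field_simp
      ring
    · rw [h3]
      simp only [Matrix.mul_apply, Fin.sum_univ_two, of_apply, cons_val_zero, cons_val_one, hc,
        cons_val', cons_val_fin_one]
      ring
  · obtain ⟨x, hx⟩ : ∃ x, -ρ z 1 0 * (x * x) + (ρ z 0 0 - ρ z 1 1) * x + ρ z 0 1 = 0 := by
      let p : K[X] := C (-ρ z 1 0) * X ^ 2 + C (ρ z 0 0 - ρ z 1 1) * X + C (ρ z 0 1)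
      have hp : p.degree ≠ 0 := by
        rw [degree_quadratic (neg_ne_zero.2 hc)]
        decide
      obtain ⟨x, hx⟩ := IsAlgClosed.exists_root p hp
      refine ⟨x, ?_⟩
      have : p.eval x = 0 := hx
      simp only [p, eval_add, eval_mul, eval_C, eval_pow, eval_X] at this
      linear_combination this
    obtain ⟨ρ', h1, h2, h3⟩ := exists_conj_rep ρ hρ hdet (upper x)
    have h01 : ρ' z 0 1 = 0 := by
      rw [h3]
      simp only [Matrix.mul_apply, Fin.sum_univ_two, of_apply, cons_val_zero, cons_val_one,
        cons_val', cons_val_fin_one]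
      linear_combination hx
    have hne := sub_ne_zero.2 (key ρ' h1 h2 (Or.inl h01))
    obtain ⟨ρ'', h1', h2', h3'⟩ := exists_conj_rep ρ' h1 h2
      (lower (ρ' z 1 0 / (ρ' z 0 0 - ρ' z 1 1)))
    refine ⟨ρ'', h1', h2', ?_, ?_⟩
    · rw [h3']
      simp only [Matrix.mul_apply, Fin.sum_univ_two, of_apply, cons_val_zero, cons_val_one, h01,
        cons_val', cons_val_fin_one]
      ring
    · rw [h3']
      simp only [Matrix.mul_apply, Fin.sum_univ_two, of_apply, cons_val_zero, cons_val_one, h01,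
        cons_val', cons_val_fin_one]
      field_simp
      ring

section Diagonal

variable {ι K : Type*} [Field K] {ρ : FreeGroup ι →* Matrix (Fin 2) (Fin 2) K}
  {z : FreeGroup ι}

theorem diagonal_ne [CharP K 2] (hρ : Function.Injective ρ) (hdet : ∀ w, (ρ w).det = 1) (hz : z ≠ 1)
    (h01 : ρ z 0 1 = 0) : ρ z 0 0 ≠ ρ z 1 1 := fun h =>
  hz (FreeGroup.eq_one_of_map_sq hρ (sq_eq_one_of_unipotent (hdet z) (Or.inl h01) h))

theorem off_diagonal_of_commute (hne : ρ z 0 0 ≠ ρ z 1 1) (h01 : ρ z 0 1 = 0)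
    (h10 : ρ z 1 0 = 0) {a : FreeGroup ι} (h : Commute a z) : ρ a 0 1 = 0 ∧ ρ a 1 0 = 0 := by
  have h' := (h.map ρ).eq
  have e1 := congrFun (congrFun h' 0) 1
  have e2 := congrFun (congrFun h' 1) 0
  simp only [Matrix.mul_apply, Fin.sum_univ_two, h01, h10, mul_zero, zero_mul, zero_add,
    add_zero] at e1 e2
  have hs := sub_ne_zero.2 hne
  constructor
  · refine (mul_eq_zero.1 (?_ : (ρ z 0 0 - ρ z 1 1) * ρ a 0 1 = 0)).resolve_left hs
    linear_combination -e1
  · refine (mul_eq_zero.1 (?_ : (ρ z 0 0 - ρ z 1 1) * ρ a 1 0 = 0)).resolve_left hs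
    linear_combination e2

theorem commute_of_diagonal (hρ : Function.Injective ρ) {a b : FreeGroup ι}
    (ha : ρ a 0 1 = 0 ∧ ρ a 1 0 = 0) (hb : ρ b 0 1 = 0 ∧ ρ b 1 0 = 0) : Commute a b := by
  apply hρ
  rw [map_mul, map_mul]
  ext i j
  fin_cases i <;> fin_cases j <;> simp [Matrix.mul_apply, ha, hb, mul_comm]

theorem commute_of_off_diagonal [CharP K 2] (hρ : Function.Injective ρ) (hdet : ∀ w, (ρ w).det = 1)
    (h01 : ρ z 0 1 = 0) (h10 : ρ z 1 0 = 0) {a : FreeGroup ι}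
    (h : ρ a 0 1 = 0 ∨ ρ a 1 0 = 0) : Commute a z := by
  have hz := hdet z
  have hinv : ∀ w, ρ w⁻¹ = !![ρ w 1 1, -ρ w 0 1; -ρ w 1 0, ρ w 0 0] := by
    intro w
    have e : ρ w * ρ w⁻¹ = 1 := by rw [← map_mul, mul_inv_cancel, map_one]
    rw [← Matrix.inv_eq_right_inv e, Matrix.inv_def, hdet, Matrix.adjugate_fin_two]
    simp
  have ha := hdet a
  rw [Matrix.det_fin_two] at hz ha
  rw [h01, zero_mul, sub_zero] at hz
  have hw : a * z * (a⁻¹ * z⁻¹) = 1 := by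
    apply FreeGroup.eq_one_of_map_sq hρ
    apply sq_eq_one_of_unipotent (hdet _)
    · simp only [map_mul, hinv, Matrix.mul_apply, Fin.sum_univ_two, of_apply, cons_val_zero,
        cons_val_one, cons_val', cons_val_fin_one, h01, h10]
      rcases h with h | h
      · left; simp [h]
      · right; simp [h]
    · simp only [map_mul, hinv, Matrix.mul_apply, Fin.sum_univ_two, of_apply, cons_val_zero,
        cons_val_one, cons_val', cons_val_fin_one, h01, h10]
      rcases h with h | h <;> rw [h] <;> ring
  rw [← _root_.mul_inv_rev, mul_inv_eq_one] at hw
  exact hw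

end Diagonal

section FreeGroup

variable {ι : Type*}

/-- Free groups are commutative transitive. -/
theorem FreeGroup.commute_trans {x y w : FreeGroup ι} (hx : x ≠ 1) (hy : Commute y x)
    (hw : Commute w x) : Commute y w := by
  obtain ⟨K, _, _, ρ, hρ, hdet, h01, h10⟩ := exists_diagonal_rep x hx
  have hne := diagonal_ne hρ hdet hx h01
  exact commute_of_diagonal hρ (off_diagonal_of_commute hne h01 h10 hy)
    (off_diagonal_of_commute hne h01 h10 hw)

/-- Centralizers in free groups are malnormal. -/
theorem FreeGroup.commute_of_commute_conj {a z : FreeGroup ι} (hz : z ≠ 1)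
    (h : Commute (a * z * a⁻¹) z) : Commute a z := by
  obtain ⟨K, _, _, ρ, hρ, hdet, h01, h10⟩ := exists_diagonal_rep z hz
  have hne := diagonal_ne hρ hdet hz h01
  by_cases hb : ρ a 0 1 = 0
  · exact commute_of_off_diagonal hρ hdet h01 h10 (Or.inl hb)
  by_cases hc : ρ a 1 0 = 0
  · exact commute_of_off_diagonal hρ hdet h01 h10 (Or.inr hc)
  obtain ⟨k1, k2⟩ := off_diagonal_of_commute hne h01 h10 h
  set y := a * z * a⁻¹ with hy
  have e : ρ y * ρ a = ρ a * ρ z := by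
    rw [← _root_.map_mul, ← _root_.map_mul, hy, inv_mul_cancel_right]
  have e00 := congrFun (congrFun e 0) 0
  have e01 := congrFun (congrFun e 0) 1
  have e10 := congrFun (congrFun e 1) 0
  have e11 := congrFun (congrFun e 1) 1
  simp only [Matrix.mul_apply, Fin.sum_univ_two, h01, h10, k1, k2, mul_zero, zero_mul, zero_add,
    add_zero] at e00 e01 e10 e11
  rw [mul_comm (ρ a 0 1)] at e01
  rw [mul_comm (ρ a 1 0)] at e10
  rw [mul_right_cancel₀ hb e01] at e00
  rw [mul_right_cancel₀ hc e10] at e11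
  have hs := sub_ne_zero.2 hne
  have a00 : ρ a 0 0 = 0 := by
    refine (mul_eq_zero.1 (?_ : (ρ z 0 0 - ρ z 1 1) * ρ a 0 0 = 0)).resolve_left hs
    linear_combination -e00
  have a11 : ρ a 1 1 = 0 := by
    refine (mul_eq_zero.1 (?_ : (ρ z 0 0 - ρ z 1 1) * ρ a 1 1 = 0)).resolve_left hs
    linear_combination e11
  have ha := hdet a
  rw [Matrix.det_fin_two, a00, zero_mul, zero_sub, CharTwo.neg_eq] at ha
  have h1 : a = 1 := by
    apply FreeGroup.eq_one_of_map_sq hρ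
    ext i j
    fin_cases i <;> fin_cases j <;>
      simp [pow_two, Matrix.mul_apply, a00, a11, ha, mul_comm (ρ a 1 0)]
  rw [h1]
  exact Commute.one_left z

end FreeGroup

section Baumslag

/-- In a product of matrices with zero second column the first row is nonzero, under
mild conditions. -/
theorem rankOne_row_prod {K : Type*} [Field K] {α : Type*} (N : α → Matrix (Fin 2) (Fin 2) K)
    (hN : ∀ x, N x 1 = 0) (L : List α) (hL : L ≠ []) (hrow : ∀ x ∈ L, N x 0 ≠ 0)
    (hchain : L.IsChain fun x _ => N x 0 0 ≠ 0) :
    ∃ j, (L.map N).prod 0 j ≠ 0 := by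
  induction L with
  | nil => exact absurd rfl hL
  | cons x L ih =>
    cases L with
    | nil =>
      have := hrow x (by simp)
      simpa [Function.ne_iff] using this
    | cons y L =>
      rw [List.isChain_cons_cons] at hchain
      obtain ⟨j, hj⟩ := ih (by simp) (fun x hx => hrow x (List.mem_cons_of_mem _ hx)) hchain.2
      refine ⟨j, ?_⟩
      have h1 : (List.map N (y :: L)).prod 1 j = 0 := by
        rw [List.map_cons, List.prod_cons, Matrix.mul_apply]
        simp [hN]
      rw [List.map_cons, List.prod_cons, Matrix.mul_apply, Fin.sum_univ_two, h1, mul_zero, add_zero]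
      exact mul_ne_zero hchain.1 hj

theorem pow_injective_of_ne_one {ι : Type*} {z : FreeGroup ι} (hz : z ≠ 1) :
    Function.Injective fun m : ℕ => z ^ m := by
  rw [injective_pow_iff_not_isOfFinOrder]
  exact fun h => hz ((isOfFinOrder_iff_eq_one z).1 h)

/-- Baumslag's lemma on powers in free groups. -/
theorem eventually_conj_pow_prod_ne_one {ι : Type*} {z : FreeGroup ι} (hz : z ≠ 1)
    (a : FreeGroup ι) (L : List (FreeGroup ι × FreeGroup ι)) (hL : L ≠ [])
    (h1 : ∀ x ∈ L, ¬Commute x.1 z) (h2 : L.IsChain fun x _ => ¬Commute x.2 z) :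
    ∀ᶠ m : ℕ in Filter.cofinite,
      a * (L.map fun x => z ^ m * x.1 * (z ^ m)⁻¹ * x.2).prod ≠ 1 := by
  obtain ⟨K, _, _, ρ, hρ, hdet, h01, h10⟩ := exists_diagonal_rep z hz
  have hz1 := hdet z
  rw [Matrix.det_fin_two, h01, zero_mul, sub_zero] at hz1
  set l := ρ z 0 0 with hl
  set u := ρ z 1 1 with hu
  have hzd : ρ z = Matrix.diagonal ![l, u] := by
    ext i j
    fin_cases i <;> fin_cases j <;> simp [h01, h10, hl, hu]
  have hzm : ∀ m : ℕ, ρ (z ^ m) = Matrix.diagonal ![l ^ m, u ^ m] := by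
    intro m
    rw [map_pow, hzd, Matrix.diagonal_pow]
    congr 1
    ext i
    fin_cases i <;> simp
  have hlu : ∀ m : ℕ, l ^ m * u ^ m = 1 := fun m => by rw [← mul_pow, hz1, one_pow]
  have hzi : ∀ m : ℕ, ρ (z ^ m)⁻¹ = Matrix.diagonal ![u ^ m, l ^ m] := by
    intro m
    have e : ρ (z ^ m) * ρ (z ^ m)⁻¹ = 1 := by rw [← map_mul, mul_inv_cancel, map_one]
    rw [← Matrix.inv_eq_right_inv e]
    apply Matrix.inv_eq_right_inv
    rw [hzm, Matrix.diagonal_mul_diagonal, ← Matrix.diagonal_one]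
    congr 1
    ext i
    fin_cases i <;> simp [hlu, mul_comm (u ^ m)]
  let s : ℕ → K := fun m => l ^ (2 * m)
  have hs : Function.Injective s := by
    intro m k hmk
    have hmk : l ^ (2 * m) = l ^ (2 * k) := hmk
    have hu' : u ^ (2 * m) = u ^ (2 * k) := by
      rw [eq_inv_of_mul_eq_one_right (hlu (2 * m)), hmk,
        ← eq_inv_of_mul_eq_one_right (hlu (2 * k))]
    have : z ^ (2 * m) = z ^ (2 * k) := hρ (by rw [hzm, hzm, hmk, hu'])
    have := pow_injective_of_ne_one hz this
    omega
  let N : FreeGroup ι × FreeGroup ι → Matrix (Fin 2) (Fin 2) K[X] := fun x =>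
    !![C (ρ x.1 0 0) * X, C (ρ x.1 0 1) * X ^ 2; C (ρ x.1 1 0), C (ρ x.1 1 1) * X] *
      (ρ x.2).map C
  have hN0 : ∀ x j, N x 0 j = C (ρ x.1 0 0 * ρ x.2 0 j) * X +
      C (ρ x.1 0 1 * ρ x.2 1 j) * X ^ 2 := by
    intro x j
    rw [C_mul, C_mul, mul_right_comm, mul_right_comm (C (ρ x.1 0 1))]
    simp only [N, Matrix.mul_apply, Fin.sum_univ_two]
    rfl
  have hN1 : ∀ x j, N x 1 j = C (ρ x.1 1 0 * ρ x.2 0 j) +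
      C (ρ x.1 1 1 * ρ x.2 1 j) * X := by
    intro x j
    rw [C_mul, C_mul, mul_right_comm (C (ρ x.1 1 1))]
    simp only [N, Matrix.mul_apply, Fin.sum_univ_two]
    rfl
  have hNdeg : ∀ x i j, (N x i j).natDegree ≤ 2 := by
    intro x i j
    fin_cases i
    · simp only [Fin.zero_eta, hN0]
      compute_degree
    · simp only [Fin.mk_one, hN1]
      compute_degree!
  let R : FreeGroup ι × FreeGroup ι → Matrix (Fin 2) (Fin 2) K := fun x =>
    (N x).map fun p => p.coeff 2
  have hR0 : ∀ x j, R x 0 j = ρ x.1 0 1 * ρ x.2 1 j := by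
    intro x j
    simp only [R, Matrix.map_apply, hN0]
    rw [coeff_add, coeff_C_mul, coeff_C_mul, coeff_X, coeff_X_pow]
    simp
  have hR1 : ∀ x, R x 1 = 0 := by
    intro x
    ext j
    simp only [R, Matrix.map_apply, hN1]
    rw [coeff_add, coeff_C_mul, coeff_X, coeff_C]
    simp
  have hNeval : ∀ x m, (N x).map (evalRingHom (s m)) =
      s m • ρ (z ^ m * x.1 * (z ^ m)⁻¹ * x.2) := by
    intro x m
    have e1 : s m = l ^ m * l ^ m := by simp only [s, two_mul, pow_add]
    have e2 := hlu m
    rw [map_mul, map_mul, map_mul, hzm, hzi]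
    ext i j
    fin_cases i
    · simp only [Fin.zero_eta, Matrix.map_apply, hN0, Matrix.smul_apply, Matrix.mul_apply,
        Fin.sum_univ_two, Matrix.diagonal_apply, smul_eq_mul]
      simp
      rw [e1]
      linear_combination (-l ^ m * l ^ m * ρ x.1 0 0 * ρ x.2 0 j) * e2
    · simp only [Fin.mk_one, Matrix.map_apply, hN1, Matrix.smul_apply, Matrix.mul_apply,
        Fin.sum_univ_two, Matrix.diagonal_apply, smul_eq_mul]
      simp
      rw [e1]
      linear_combination (-(ρ x.1 1 0 * ρ x.2 0 j * (l ^ m * u ^ m + 1)) -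
        l ^ m * l ^ m * ρ x.1 1 1 * ρ x.2 1 j) * e2
  have hprod : ∀ m, ((L.map N).prod).map (evalRingHom (s m)) =
      s m ^ L.length • ρ (L.map fun x => z ^ m * x.1 * (z ^ m)⁻¹ * x.2).prod := by
    intro m
    clear h1 h2 hL
    induction L with
    | nil => ext i j; fin_cases i <;> fin_cases j <;> simp
    | cons x L ih =>
      rw [List.map_cons, List.prod_cons, Matrix.map_mul, hNeval, ih, List.map_cons, List.prod_cons,
        map_mul ρ (_ * x.2), List.length_cons, smul_mul_smul_comm, pow_succ']
  have h01' : ∀ b, ¬Commute b z → ρ b 0 1 ≠ 0 := fun b hb h =>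
    hb (commute_of_off_diagonal hρ hdet h01 h10 (Or.inl h))
  have h10' : ∀ b, ¬Commute b z → ρ b 1 0 ≠ 0 := fun b hb h =>
    hb (commute_of_off_diagonal hρ hdet h01 h10 (Or.inr h))
  obtain ⟨j, hj⟩ := rankOne_row_prod R hR1 L hL
    (by
      intro x hx h0
      have e0 := congrFun h0 0
      have e1 := congrFun h0 1
      rw [hR0, Pi.zero_apply] at e0 e1
      have e0 := (mul_eq_zero.1 e0).resolve_left (h01' _ (h1 x hx))
      have e1 := (mul_eq_zero.1 e1).resolve_left (h01' _ (h1 x hx))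
      have := hdet x.2
      rw [Matrix.det_fin_two, e0, e1] at this
      simp at this)
    (by
      refine List.IsChain.imp_of_mem_imp ?_ h2
      intro x y hx _ h
      rw [hR0]
      exact mul_ne_zero (h01' _ (h1 x hx)) (h10' _ h))
  have hcoeff := coeff_matrix_list_prod 2 (L.map N) (by
    intro M hM
    obtain ⟨x, _, rfl⟩ := List.mem_map.1 hM
    exact hNdeg x)
  rw [List.length_map, List.map_map] at hcoeff
  let P : K[X] := (L.map N).prod 0 j - C (ρ a⁻¹ 0 j) * X ^ L.length
  have hP : P ≠ 0 := by
    intro h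
    have h' : P.coeff (L.length * 2) = (L.map R).prod 0 j := by
      have := congrFun (congrFun hcoeff 0) j
      rw [Matrix.map_apply] at this
      have hpos := List.length_pos_iff.2 hL
      rw [coeff_sub, this, coeff_C_mul, coeff_X_pow, if_neg (by omega), mul_zero, sub_zero]
      rfl
    rw [h, coeff_zero] at h'
    exact hj h'.symm
  refine ((P.rootSet_finite K).preimage hs.injOn).subset ?_
  intro m hm
  have hm : a * (L.map fun x => z ^ m * x.1 * (z ^ m)⁻¹ * x.2).prod = 1 := by
    simpa using hm
  rw [Set.mem_preimage, mem_rootSet]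
  refine ⟨hP, ?_⟩
  have := congrFun (congrFun (hprod m) 0) j
  rw [eq_inv_of_mul_eq_one_right hm, Matrix.map_apply, coe_evalRingHom] at this
  simp only [P, map_sub, map_mul, aeval_C, coe_aeval_eq_eval, this, map_pow, eval_X]
  simp [mul_comm]

end Baumslag

end Representations

section Centralizer

theorem subsingleton_of_freeGroup_commute {X : Type*} (h : ∀ a b : FreeGroup X, Commute a b) :
    Subsingleton X := by
  classical
  refine ⟨fun i j => by_contra fun hij => ?_⟩
  let f : FreeGroup X →* Equiv.Perm (Fin 3) :=
    FreeGroup.lift fun x => if x = i then Equiv.swap 0 1 else Equiv.swap 1 2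
  have := (h (FreeGroup.of i) (FreeGroup.of j)).map f
  simp only [f, FreeGroup.lift_apply_of, if_neg (Ne.symm hij), if_true] at this
  revert this
  simp only [commute_iff_eq]
  decide

/-- The centralizer of an element of a free group that is not a proper power is generated by it. -/
theorem mem_zpowers_of_commute {X : Type*} {r : FreeGroup X} (hr : r ≠ 1)
    (hroot : ∀ (y : FreeGroup X) (k : ℤ), y ^ k = r → k = 1 ∨ k = -1) {a : FreeGroup X}
    (ha : Commute a r) : a ∈ Subgroup.zpowers r := by
  let H := Subgroup.centralizer {r}
  have hmem : ∀ x, Commute x r → x ∈ H := fun x hx => Subgroup.mem_centralizer_singleton_iff.2 hx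
  let e := IsFreeGroup.toFreeGroup H
  have hcomm : ∀ x y : H, Commute x y := fun x y =>
    Subtype.ext (FreeGroup.commute_trans hr (Subgroup.mem_centralizer_singleton_iff.1 x.2)
      (Subgroup.mem_centralizer_singleton_iff.1 y.2))
  have hsub : Subsingleton (IsFreeGroup.Generators H) :=
    subsingleton_of_freeGroup_commute fun x y => by
      simpa using (hcomm (e.symm x) (e.symm y)).map e
  have hcyc : ∃ y : FreeGroup X, ∀ x, Commute x r → ∃ k : ℤ, x = y ^ k := by
    by_cases hne : Nonempty (IsFreeGroup.Generators H)
    · obtain ⟨i⟩ := hne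
      refine ⟨(e.symm (FreeGroup.of i) : H), fun x hx => ?_⟩
      have : ∀ w : FreeGroup (IsFreeGroup.Generators H), w ∈ Subgroup.zpowers (FreeGroup.of i) := by
        intro w
        induction w using FreeGroup.induction_on with
        | C1 => exact one_mem _
        | of j => rw [Subsingleton.elim j i]; exact Subgroup.mem_zpowers _
        | inv_of j h => exact inv_mem h
        | mul v w hv hw => exact mul_mem hv hw
      obtain ⟨k, hk⟩ := Subgroup.mem_zpowers_iff.1 (this (e ⟨x, hmem x hx⟩))
      refine ⟨k, ?_⟩
      have := congrArg (fun w => ((e.symm w : H) : FreeGroup X)) hk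
      simpa using this.symm
    · have := not_nonempty_iff.1 hne
      refine ⟨1, fun x hx => ⟨0, ?_⟩⟩
      have : (⟨x, hmem x hx⟩ : H) = 1 := e.injective (Subsingleton.elim _ _)
      simpa using congrArg Subtype.val this
  obtain ⟨y, hy⟩ := hcyc
  obtain ⟨k, hk⟩ := hy r (Commute.refl r)
  obtain ⟨m, hm⟩ := hy a ha
  rw [Subgroup.mem_zpowers_iff]
  rcases hroot y k hk.symm with rfl | rfl
  · exact ⟨m, by rw [hk, hm, zpow_one]⟩
  · exact ⟨-m, by rw [hk, hm]; simp⟩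

theorem mem_zpowers_of_commute_of {X : Type*} (x : X) {a : FreeGroup X}
    (ha : Commute a (FreeGroup.of x)) : a ∈ Subgroup.zpowers (FreeGroup.of x) := by
  refine mem_zpowers_of_commute (FreeGroup.of_ne_one x) (fun y k hk => ?_) ha
  let f : FreeGroup X →* Multiplicative ℤ := FreeGroup.lift fun _ => Multiplicative.ofAdd 1
  have := congrArg (fun w => (f w).toAdd) hk
  simp only [f, map_zpow, toAdd_zpow, FreeGroup.lift_apply_of, toAdd_ofAdd, smul_eq_mul] at this
  exact Int.eq_one_or_neg_one_of_mul_eq_one this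

/-- The integral Heisenberg group. -/
@[ext]
structure Heisenberg where
  /-- the first coordinate -/
  x : ℤ
  /-- the second coordinate -/
  y : ℤ
  /-- the central coordinate -/
  t : ℤ

namespace Heisenberg

instance : Mul Heisenberg := ⟨fun p q => ⟨p.x + q.x, p.y + q.y, p.t + q.t + p.x * q.y⟩⟩
instance : One Heisenberg := ⟨⟨0, 0, 0⟩⟩
instance : Inv Heisenberg := ⟨fun p => ⟨-p.x, -p.y, -p.t + p.x * p.y⟩⟩

theorem mul_def (p q : Heisenberg) :
    p * q = ⟨p.x + q.x, p.y + q.y, p.t + q.t + p.x * q.y⟩ := rfl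

theorem one_def : (1 : Heisenberg) = ⟨0, 0, 0⟩ := rfl

theorem inv_def (p : Heisenberg) : p⁻¹ = ⟨-p.x, -p.y, -p.t + p.x * p.y⟩ := rfl

instance : Group Heisenberg :=
  Group.ofLeftAxioms
    (fun p q r => by ext <;> simp only [mul_def] <;> ring)
    (fun p => by ext <;> simp [mul_def, one_def])
    (fun p => by ext <;> simp only [mul_def, one_def, inv_def] <;> ring)

/-- Abelianization of the Heisenberg group. -/
def proj : Heisenberg →* Multiplicative (ℤ × ℤ) where
  toFun p := Multiplicative.ofAdd (p.x, p.y)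
  map_one' := rfl
  map_mul' _ _ := rfl

/-- The centre of the Heisenberg group. -/
def central : Multiplicative ℤ →* Heisenberg where
  toFun t := ⟨0, 0, t.toAdd⟩
  map_one' := rfl
  map_mul' s t := by ext <;> simp [mul_def]

theorem zpow_eq_central {p : Heisenberg} {k : ℤ} (h : p ^ k = ⟨0, 0, 1⟩) : k = 1 ∨ k = -1 := by
  have hk : k ≠ 0 := by
    rintro rfl
    rw [zpow_zero, one_def] at h
    simp at h
  have h1 : k • (p.x, p.y) = 0 := by
    have := congrArg (fun q => (proj q).toAdd) h
    simpa [map_zpow, proj] using this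
  have h2 : (p.x, p.y) = 0 := (smul_eq_zero.1 h1).resolve_left hk
  have h3 : p = central (Multiplicative.ofAdd p.t) := by
    ext
    · exact congrArg Prod.fst h2
    · exact congrArg Prod.snd h2
    · rfl
  rw [h3, ← map_zpow, ← ofAdd_zsmul] at h
  exact Int.eq_one_or_neg_one_of_mul_eq_one (congrArg Heisenberg.t h)

end Heisenberg

end Centralizer

section Amalgam

open Filter

/-- `Separates X φ` says that the automorphisms fixing `X` pointwise can be used to make `φ`
injective on any given finite set. -/
def Separates {G H : Type*} [Group G] [Group H] (X : Set G) (φ : G →* H) : Prop :=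
  ∃ l : Filter (MulAut G), l.NeBot ∧ (∀ᶠ α in l, ∀ x ∈ X, α x = x) ∧
    ∀ w, w ≠ 1 → ∀ᶠ α in l, φ (α w) ≠ 1

theorem separates_of_injective {G H : Type*} [Group G] [Group H] (X : Set G) {φ : G →* H}
    (hφ : Function.Injective φ) : Separates X φ :=
  ⟨pure 1, inferInstance, by simp, fun w hw => by
    simpa using (map_ne_one_iff φ hφ).2 hw⟩

theorem Separates.precomp {G H : Type*} [Group G] [Group H] {X : Set G} {φ : G →* H}
    (β : MulAut G) (hβ : ∀ x ∈ X, β x = x) (h : Separates X (φ.comp β.toMonoidHom)) :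
    Separates X φ := by
  obtain ⟨l, hl, h1, h2⟩ := h
  refine ⟨l.map (β * ·), hl.map _, ?_, ?_⟩
  · rw [eventually_map]
    filter_upwards [h1] with α hα x hx
    rw [MulAut.mul_apply, hα x hx, hβ x hx]
  · intro w hw
    rw [eventually_map]
    exact h2 w hw

theorem not_commute_of_map_commutator_ne_one {G H : Type*} [Group G] [Group H] (φ : G →* H)
    {a b : G} (h : φ (a * b * (b * a)⁻¹) ≠ 1) : ¬Commute (φ a) (φ b) := by
  intro hc
  apply h
  rw [map_mul, map_inv, map_mul, map_mul, hc.eq, mul_inv_cancel]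

variable {A B G : Type*} [Group A] [Group B] [Group G]

theorem exists_amalgam_normal_form (iA : A →* G) (iB : B →* G) {cA : A} {cB : B}
    (hc : iA cA = iB cB) (hgen : Subgroup.closure (Set.range iA ∪ Set.range iB) = ⊤) (w : G) :
    ∃ (a : A) (L : List (B × A)), w = iA a * (L.map fun x => iB x.1 * iA x.2).prod ∧
      (∀ x ∈ L, x.1 ∉ Subgroup.zpowers cB) ∧ L.IsChain fun x _ => x.2 ∉ Subgroup.zpowers cA := by
  have hcz : ∀ k : ℤ, iA (cA ^ k) = iB (cB ^ k) := fun k => by rw [map_zpow, map_zpow, hc]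
  let P : G → Prop := fun w =>
    ∃ (a : A) (L : List (B × A)), w = iA a * (L.map fun x => iB x.1 * iA x.2).prod ∧
      (∀ x ∈ L, x.1 ∉ Subgroup.zpowers cB) ∧ L.IsChain fun x _ => x.2 ∉ Subgroup.zpowers cA
  have hA : ∀ a w, P w → P (iA a * w) := by
    rintro a _ ⟨a0, L, rfl, h1, h2⟩
    exact ⟨a * a0, L, by rw [map_mul, mul_assoc], h1, h2⟩
  have hB : ∀ b w, P w → P (iB b * w) := by
    intro b w hw
    by_cases hb : b ∈ Subgroup.zpowers cB
    · obtain ⟨k, rfl⟩ := Subgroup.mem_zpowers_iff.1 hb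
      rw [← hcz]
      exact hA _ _ hw
    obtain ⟨a0, L, rfl, h1, h2⟩ := hw
    by_cases ha : a0 ∈ Subgroup.zpowers cA
    · cases L with
      | nil => exact ⟨1, [(b, a0)], by simp, by simpa using hb, List.isChain_singleton _⟩
      | cons y L =>
        obtain ⟨k, rfl⟩ := Subgroup.mem_zpowers_iff.1 ha
        have h1' : ∀ x ∈ L, x.1 ∉ Subgroup.zpowers cB :=
          fun x hx => h1 x (List.mem_cons_of_mem _ hx)
        have e : iB b * (iA (cA ^ k) * (List.map (fun x => iB x.1 * iA x.2) (y :: L)).prod) =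
            iB (b * cB ^ k * y.1) * iA y.2 * (List.map (fun x => iB x.1 * iA x.2) L).prod := by
          rw [hcz, List.map_cons, List.prod_cons, map_mul, map_mul]
          simp only [mul_assoc]
        by_cases hb' : b * cB ^ k * y.1 ∈ Subgroup.zpowers cB
        · obtain ⟨j, hj⟩ := Subgroup.mem_zpowers_iff.1 hb'
          refine ⟨cA ^ j * y.2, L, ?_, h1', h2.tail⟩
          rw [e, ← hj, ← hcz, map_mul]
        · refine ⟨1, (b * cB ^ k * y.1, y.2) :: L, ?_, ?_, ?_⟩
          · rw [e, List.map_cons, List.prod_cons, map_one, one_mul]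
          · intro x hx
            rcases List.mem_cons.1 hx with rfl | hx
            · exact hb'
            · exact h1' x hx
          · cases L with
            | nil => exact List.isChain_singleton _
            | cons v L =>
              rw [List.isChain_cons_cons] at h2 ⊢
              exact h2
    · refine ⟨1, (b, a0) :: L, ?_, ?_, ?_⟩
      · rw [List.map_cons, List.prod_cons, map_one, one_mul, mul_assoc]
      · intro x hx
        rcases List.mem_cons.1 hx with rfl | hx
        · exact hb
        · exact h1 x hx
      · cases L with
        | nil => exact List.isChain_singleton _
        | cons v L => exact List.isChain_cons_cons.2 ⟨ha, h2⟩
  have hw : w ∈ Subgroup.closure (Set.range iA ∪ Set.range iB) := hgen ▸ Subgroup.mem_top w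
  change P w
  induction hw using Subgroup.closure_induction_left with
  | one => exact ⟨1, [], by simp, by simp, List.isChain_nil⟩
  | mul_left x hx y _ hy =>
    rcases hx with ⟨a, rfl⟩ | ⟨b, rfl⟩
    · exact hA _ _ hy
    · exact hB _ _ hy
  | inv_mul_cancel x hx y _ hy =>
    rcases hx with ⟨a, rfl⟩ | ⟨b, rfl⟩
    · rw [← map_inv]; exact hA _ _ hy
    · rw [← map_inv]; exact hB _ _ hy

theorem exists_amalgam_twist (iA : A →* G) (iB : B →* G) {cA : A} {cB : B}
    (hc : iA cA = iB cB)
    (hlift : ∀ (fA : A →* G) (fB : B →* G), fA cA = fB cB →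
      ∃ f : G →* G, (∀ a, f (iA a) = fA a) ∧ ∀ b, f (iB b) = fB b)
    (hgen : Subgroup.closure (Set.range iA ∪ Set.range iB) = ⊤)
    (αA : MulAut A) (αB : MulAut B) (hαA : αA cA = cA) (hαB : αB cB = cB) (m : ℤ) :
    ∃ T : MulAut G, (∀ a, T (iA a) = iA (αA a)) ∧
      ∀ b, T (iB b) = iA cA ^ m * iB (αB b) * (iA cA ^ m)⁻¹ := by
  have hT : ∀ (αA : MulAut A) (αB : MulAut B), αA cA = cA → αB cB = cB → ∀ m : ℤ,
      ∃ T : G →* G, (∀ a, T (iA a) = iA (αA a)) ∧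
        ∀ b, T (iB b) = iA cA ^ m * iB (αB b) * (iA cA ^ m)⁻¹ := by
    intro αA αB hαA hαB m
    refine hlift (iA.comp αA.toMonoidHom)
      (((MulAut.conj (iA cA ^ m)).toMonoidHom.comp iB).comp αB.toMonoidHom) ?_
    change iA (αA cA) = iA cA ^ m * iB (αB cB) * (iA cA ^ m)⁻¹
    rw [hαA, hαB, ← hc, ← zpow_neg, mul_assoc, ← zpow_one_add, ← _root_.zpow_add]
    simp
  have hid : ∀ f : G →* G, (∀ a, f (iA a) = iA a) → (∀ b, f (iB b) = iB b) → ∀ w, f w = w := by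
    intro f h1 h2 w
    have : f = MonoidHom.id G := by
      refine MonoidHom.eq_of_eqOn_dense hgen ?_
      rintro _ (⟨a, rfl⟩ | ⟨b, rfl⟩)
      · exact h1 a
      · exact h2 b
    rw [this, MonoidHom.id_apply]
  have hinv : ∀ (αA : MulAut A) (αB : MulAut B) (m : ℤ) (S T : G →* G), αA cA = cA →
      (∀ a, S (iA a) = iA (αA⁻¹ a)) →
      (∀ b, S (iB b) = iA cA ^ (-m) * iB (αB⁻¹ b) * (iA cA ^ (-m))⁻¹) →
      (∀ a, T (iA a) = iA (αA a)) →
      (∀ b, T (iB b) = iA cA ^ m * iB (αB b) * (iA cA ^ m)⁻¹) → ∀ w, T (S w) = w := by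
    intro αA αB m S T hα h1 h2 h3 h4
    refine hid (T.comp S) (fun a => ?_) fun b => ?_
    · simp [h1, h3]
    · have : T (iA cA) = iA cA := by rw [h3, hα]
      simp only [MonoidHom.comp_apply, h2, map_mul, map_inv, map_zpow, this, h4]
      simp [mul_assoc]
  have hαA' : αA⁻¹ cA = cA := by rw [MulAut.inv_apply, MulEquiv.symm_apply_eq, hαA]
  have hαB' : αB⁻¹ cB = cB := by rw [MulAut.inv_apply, MulEquiv.symm_apply_eq, hαB]
  obtain ⟨T, hT1, hT2⟩ := hT αA αB hαA hαB m
  obtain ⟨S, hS1, hS2⟩ := hT αA⁻¹ αB⁻¹ hαA' hαB' (-m)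
  refine ⟨MonoidHom.toMulEquiv T S (MonoidHom.ext fun w => ?_) (MonoidHom.ext fun w => ?_),
    hT1, hT2⟩
  · exact hinv αA⁻¹ αB⁻¹ (-m) T S hαA' (by simpa using hT1) (by simpa using hT2) hS1 hS2 w
  · exact hinv αA αB m S T hαA hS1 hS2 hT1 hT2 w

/-- Separation passes to amalgamated products over a maximal cyclic subgroup. -/
theorem Separates.amalgam {ι : Type*} (iA : A →* G) (iB : B →* G) {cA : A} {cB : B}
    (hc : iA cA = iB cB)
    (hlift : ∀ (fA : A →* G) (fB : B →* G), fA cA = fB cB →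
      ∃ f : G →* G, (∀ a, f (iA a) = fA a) ∧ ∀ b, f (iB b) = fB b)
    (hgen : Subgroup.closure (Set.range iA ∪ Set.range iB) = ⊤)
    (hA : ∀ a, Commute a cA → a ∈ Subgroup.zpowers cA)
    (hB : ∀ b, Commute b cB → b ∈ Subgroup.zpowers cB)
    (φ : G →* FreeGroup ι) (hφ : φ (iA cA) ≠ 1) {X : Set A}
    (hsA : Separates (insert cA X) (φ.comp iA)) (hsB : Separates {cB} (φ.comp iB)) :
    Separates (iA '' X) φ := by
  obtain ⟨lA, hlA, hA1, hA2⟩ := hsA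
  obtain ⟨lB, hlB, hB1, hB2⟩ := hsB
  have hT : ∀ (p : MulAut A × MulAut B) (m : ℕ), ∃ T : MulAut G, p.1 cA = cA → p.2 cB = cB →
      (∀ a, T (iA a) = iA (p.1 a)) ∧
      ∀ b, T (iB b) = iA cA ^ m * iB (p.2 b) * (iA cA ^ m)⁻¹ := by
    intro p m
    by_cases h : p.1 cA = cA ∧ p.2 cB = cB
    · obtain ⟨T, hT⟩ := exists_amalgam_twist iA iB hc hlift hgen p.1 p.2 h.1 h.2 m
      exact ⟨T, fun _ _ => by simpa using hT⟩
    · exact ⟨1, fun h1 h2 => absurd ⟨h1, h2⟩ h⟩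
  choose T hT using hT
  have hAc : ∀ᶠ p in lA ×ˢ lB, p.1 cA = cA :=
    (hA1.mono fun α h => h _ (Set.mem_insert _ _)).prod_inl lB
  have hBc : ∀ᶠ p in lA ×ˢ lB, p.2 cB = cB :=
    (hB1.mono fun α h => h _ rfl).prod_inr lA
  refine ⟨(lA ×ˢ lB).bind fun p => map (T p) cofinite, ?_, ?_, ?_⟩
  · rw [neBot_iff, ne_eq, ← eventually_false_iff_eq_bot, eventually_bind]
    simpa using Set.infinite_univ
  · rw [eventually_bind]
    filter_upwards [hAc, hBc, hA1.prod_inl lB] with p h1 h2 h3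
    rw [eventually_map]
    refine Eventually.of_forall fun m => ?_
    rintro _ ⟨x, hx, rfl⟩
    rw [(hT p m h1 h2).1, h3 x (Set.mem_insert_of_mem _ hx)]
  · intro w hw
    rw [eventually_bind]
    simp only [eventually_map]
    obtain ⟨a, L, rfl, h1, h2⟩ := exists_amalgam_normal_form iA iB hc hgen w
    by_cases hL : L = []
    · subst hL
      simp only [List.map_nil, List.prod_nil, mul_one] at hw ⊢
      have ha : a ≠ 1 := by
        rintro rfl
        exact hw (map_one iA)
      filter_upwards [hAc, hBc, (hA2 a ha).prod_inl lB] with p h1 h2 h3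
      refine Eventually.of_forall fun m => ?_
      rw [(hT p m h1 h2).1]
      exact h3
    · have hA3 : ∀ x ∈ {x | x ∈ L}, ∀ᶠ p in lA ×ˢ lB, x.2 ∉ Subgroup.zpowers cA →
          φ (iA (p.1 (x.2 * cA * (cA * x.2)⁻¹))) ≠ 1 := by
        intro x _
        by_cases hx : x.2 ∈ Subgroup.zpowers cA
        · exact Eventually.of_forall fun p h => absurd hx h
        · refine ((hA2 _ fun h => hx (hA _ ?_)).prod_inl lB).mono fun p h _ => h
          exact mul_inv_eq_one.1 h
      have hB3 : ∀ x ∈ {x | x ∈ L}, ∀ᶠ p in lA ×ˢ lB,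
          φ (iB (p.2 (x.1 * cB * (cB * x.1)⁻¹))) ≠ 1 := by
        intro x hxL
        exact (hB2 _ fun h => h1 x hxL (hB _ (mul_inv_eq_one.1 h))).prod_inr lA
      rw [← eventually_all_finite L.finite_toSet] at hA3 hB3
      filter_upwards [hAc, hBc, hA3, hB3] with p k1 k2 k3 k4
      let M : List (FreeGroup ι × FreeGroup ι) :=
        L.map fun x => (φ (iB (p.2 x.1)), φ (iA (p.1 x.2)))
      have hM := eventually_conj_pow_prod_ne_one hφ (φ (iA (p.1 a))) M (by simpa [M] using hL)
        (by
          intro y hy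
          obtain ⟨x, hx, rfl⟩ := List.mem_map.1 hy
          have := not_commute_of_map_commutator_ne_one ((φ.comp iB).comp p.2.toMonoidHom) (k4 x hx)
          rw [hc]
          simpa [k2] using this)
        (by
          rw [List.isChain_map]
          refine List.IsChain.imp_of_mem_imp ?_ h2
          intro x y hx _ h
          have := not_commute_of_map_commutator_ne_one ((φ.comp iA).comp p.1.toMonoidHom)
            (k3 x hx h)
          simpa [k1] using this)
      filter_upwards [hM] with m hm
      convert hm using 1
      rw [map_mul, map_mul, (hT p m k1 k2).1, map_list_prod, map_list_prod, List.map_map,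
        List.map_map, List.map_map]
      congr 3
      ext x
      simp [(hT p m k1 k2).1, (hT p m k1 k2).2]

end Amalgam

section Handles

open FreeGroup
open scoped commutatorElement

/-- The inclusion of the free group on the generators that do not belong to the first handle. -/
def shift {Y : Type*} : FreeGroup Y →* FreeGroup (Bool ⊕ Y) := FreeGroup.map Sum.inr

/-- The first generator of the first handle. -/
def gA (Y : Type*) : FreeGroup (Bool ⊕ Y) := of (Sum.inl true)

/-- The second generator of the first handle. -/
def gB (Y : Type*) : FreeGroup (Bool ⊕ Y) := of (Sum.inl false)

/-- The hom from the free group on a handle and `Y` prescribed by its values. -/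
def handleLift {Y H : Type*} [Group H] (a b : H) (f : FreeGroup Y →* H) :
    FreeGroup (Bool ⊕ Y) →* H :=
  FreeGroup.lift (Sum.elim (fun i => bif i then a else b) fun y => f (of y))

section

variable {Y H : Type*} [Group H] (a b : H) (f : FreeGroup Y →* H)

@[simp] theorem handleLift_gA : handleLift a b f (gA Y) = a := by simp [handleLift, gA]

@[simp] theorem handleLift_gB : handleLift a b f (gB Y) = b := by simp [handleLift, gB]

@[simp] theorem handleLift_shift (w : FreeGroup Y) : handleLift a b f (shift w) = f w := by
  have : (handleLift a b f).comp shift = f := FreeGroup.ext_hom _ _ fun y => by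
    simp [handleLift, shift]
  exact DFunLike.congr_fun this w

theorem handle_hom_ext {f g : FreeGroup (Bool ⊕ Y) →* H} (ha : f (gA Y) = g (gA Y))
    (hb : f (gB Y) = g (gB Y)) (hs : ∀ w, f (shift w) = g (shift w)) : f = g := by
  refine FreeGroup.ext_hom _ _ ?_
  rintro ((_ | _) | y)
  · exact hb
  · exact ha
  · simpa [shift] using hs (of y)

end

/-- An automorphism of the free group on a handle and `Y` from two endomorphisms. -/
theorem exists_handle_aut {Y : Type*} (f g : FreeGroup (Bool ⊕ Y) →* FreeGroup (Bool ⊕ Y))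
    (h1 : f (g (gA Y)) = gA Y) (h2 : f (g (gB Y)) = gB Y) (h3 : ∀ w, f (g (shift w)) = shift w)
    (h1' : g (f (gA Y)) = gA Y) (h2' : g (f (gB Y)) = gB Y)
    (h3' : ∀ w, g (f (shift w)) = shift w) :
    ∃ α : MulAut (FreeGroup (Bool ⊕ Y)), ∀ w, α w = f w :=
  ⟨MonoidHom.toMulEquiv f g (handle_hom_ext h1' h2' h3') (handle_hom_ext h1 h2 h3),
    fun _ => rfl⟩

/-- Automorphisms extend by the identity on a new handle. -/
theorem exists_aut_extend {Y : Type*} (β : MulAut (FreeGroup Y)) :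
    ∃ α : MulAut (FreeGroup (Bool ⊕ Y)), α (gA Y) = gA Y ∧ α (gB Y) = gB Y ∧
      ∀ w, α (shift w) = shift (β w) := by
  obtain ⟨α, hα⟩ := exists_handle_aut
    (handleLift (gA Y) (gB Y) (shift.comp β.toMonoidHom))
    (handleLift (gA Y) (gB Y) (shift.comp β⁻¹.toMonoidHom))
    (by simp) (by simp) (by simp) (by simp) (by simp) (by simp)
  exact ⟨α, by simp [hα], by simp [hα], by simp [hα]⟩

/-- A Dehn twist about a curve in the first handle. -/
theorem exists_aut_transvection (Y : Type*) :
    ∃ α : MulAut (FreeGroup (Bool ⊕ Y)), α (gA Y) = gA Y ∧ α (gB Y) = gB Y * gA Y ∧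
      ∀ w, α (shift w) = shift w := by
  obtain ⟨α, hα⟩ := exists_handle_aut
    (handleLift (gA Y) (gB Y * gA Y) shift) (handleLift (gA Y) (gB Y * (gA Y)⁻¹) shift)
    (by simp) (by simp) (by simp) (by simp) (by simp) (by simp)
  exact ⟨α, by simp [hα], by simp [hα], by simp [hα]⟩

/-- Exchanging the first two handles. -/
theorem exists_aut_swap (X : Type*) :
    ∃ α : MulAut (FreeGroup (Bool ⊕ (Bool ⊕ X))),
      α (gA (Bool ⊕ X)) = ⁅gA (Bool ⊕ X), gB (Bool ⊕ X)⁆ * shift (gA X) *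
        ⁅gA (Bool ⊕ X), gB (Bool ⊕ X)⁆⁻¹ ∧
      α (gB (Bool ⊕ X)) = ⁅gA (Bool ⊕ X), gB (Bool ⊕ X)⁆ * shift (gB X) *
        ⁅gA (Bool ⊕ X), gB (Bool ⊕ X)⁆⁻¹ ∧
      α (shift (gA X)) = gA (Bool ⊕ X) ∧ α (shift (gB X)) = gB (Bool ⊕ X) ∧
      ∀ w : FreeGroup X, α (shift (shift w)) = shift (shift w) := by
  let c : FreeGroup (Bool ⊕ (Bool ⊕ X)) := ⁅gA (Bool ⊕ X), gB (Bool ⊕ X)⁆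
  let d : FreeGroup (Bool ⊕ (Bool ⊕ X)) := ⁅shift (gA X), shift (gB X)⁆
  let f := handleLift (c * shift (gA X) * c⁻¹) (c * shift (gB X) * c⁻¹)
    (handleLift (gA (Bool ⊕ X)) (gB (Bool ⊕ X)) (shift.comp (shift (Y := X))))
  let g := handleLift (shift (gA X)) (shift (gB X))
    (handleLift (d⁻¹ * gA (Bool ⊕ X) * d) (d⁻¹ * gB (Bool ⊕ X) * d) (shift.comp (shift (Y := X))))
  have hfd : f d = c := by simp [f, d, c, map_commutatorElement]
  have hgc : g c = d := by simp [g, d, c, map_commutatorElement]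
  have ext3 : ∀ h : FreeGroup (Bool ⊕ (Bool ⊕ X)) →* FreeGroup (Bool ⊕ (Bool ⊕ X)),
      h (shift (gA X)) = shift (gA X) → h (shift (gB X)) = shift (gB X) →
      (∀ w : FreeGroup X, h (shift (shift w)) = shift (shift w)) → ∀ w, h (shift w) = shift w :=
    fun h h1 h2 h3 w => DFunLike.congr_fun
      (handle_hom_ext (f := h.comp shift) (g := shift) h1 h2 h3) w
  obtain ⟨α, hα⟩ := exists_handle_aut f g
    (by simp [f, g]) (by simp [f, g])
    (ext3 (f.comp g) (by simp [g, hfd]; simp [f, mul_assoc])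
      (by simp [g, hfd]; simp [f, mul_assoc]) (by simp [f, g]))
    (by simp [f, hgc]; simp [g, mul_assoc]) (by simp [f, hgc]; simp [g, mul_assoc])
    (ext3 (g.comp f) (by simp [f, g]) (by simp [f, g]) (by simp [f, g]))
  exact ⟨α, by simp [hα, f, c], by simp [hα, f, c], by simp [hα, f], by simp [hα, f],
    by simp [hα, f]⟩

/-- A Dehn twist about a curve meeting the boundary of the first handle. -/
theorem exists_aut_twist (X : Type*) (z : FreeGroup (Bool ⊕ (Bool ⊕ X)))
    (hz : z = (gB (Bool ⊕ X))⁻¹ * (shift (gA X) * shift (gB X) * (shift (gA X))⁻¹)) :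
    ∃ α : MulAut (FreeGroup (Bool ⊕ (Bool ⊕ X))), α z = z ∧
      α (gA (Bool ⊕ X)) = gA (Bool ⊕ X) * z⁻¹ ∧ α (gB (Bool ⊕ X)) = z * gB (Bool ⊕ X) * z⁻¹ ∧
      α (shift (gA X)) = z * shift (gA X) ∧ α (shift (gB X)) = shift (gB X) ∧
      ∀ w : FreeGroup X, α (shift (shift w)) = shift (shift w) := by
  let f := handleLift (gA (Bool ⊕ X) * z⁻¹) (z * gB (Bool ⊕ X) * z⁻¹)
    (handleLift (z * shift (gA X)) (shift (gB X)) (shift.comp (shift (Y := X))))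
  let g := handleLift (gA (Bool ⊕ X) * z) (z⁻¹ * gB (Bool ⊕ X) * z)
    (handleLift (z⁻¹ * shift (gA X)) (shift (gB X)) (shift.comp (shift (Y := X))))
  have hf : f z = z := by
    have : f z = f ((gB (Bool ⊕ X))⁻¹ * (shift (gA X) * shift (gB X) * (shift (gA X))⁻¹)) := by
      rw [← hz]
    rw [this]
    have e : (gB (Bool ⊕ X)) * z = shift (gA X) * shift (gB X) * (shift (gA X))⁻¹ := by
      rw [hz]; group
    have : f ((gB (Bool ⊕ X))⁻¹ * (shift (gA X) * shift (gB X) * (shift (gA X))⁻¹)) =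
        z * (gB (Bool ⊕ X))⁻¹ * (shift (gA X) * shift (gB X) * (shift (gA X))⁻¹) * z⁻¹ := by
      simp [f, mul_assoc]
    rw [this, ← e]
    group
  have hg : g z = z := by
    have : g z = g ((gB (Bool ⊕ X))⁻¹ * (shift (gA X) * shift (gB X) * (shift (gA X))⁻¹)) := by
      rw [← hz]
    rw [this]
    have e : (gB (Bool ⊕ X)) * z = shift (gA X) * shift (gB X) * (shift (gA X))⁻¹ := by
      rw [hz]; group
    have : g ((gB (Bool ⊕ X))⁻¹ * (shift (gA X) * shift (gB X) * (shift (gA X))⁻¹)) =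
        z⁻¹ * (gB (Bool ⊕ X))⁻¹ * (shift (gA X) * shift (gB X) * (shift (gA X))⁻¹) * z := by
      simp [g, mul_assoc]
    rw [this, ← e]
    group
  have fA : f (gA (Bool ⊕ X)) = gA (Bool ⊕ X) * z⁻¹ := by simp [f]
  have fB : f (gB (Bool ⊕ X)) = z * gB (Bool ⊕ X) * z⁻¹ := by simp [f]
  have fA' : f (shift (gA X)) = z * shift (gA X) := by simp [f]
  have fB' : f (shift (gB X)) = shift (gB X) := by simp [f]
  have fs : ∀ w : FreeGroup X, f (shift (shift w)) = shift (shift w) := by simp [f]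
  have gA' : g (gA (Bool ⊕ X)) = gA (Bool ⊕ X) * z := by simp [g]
  have gB' : g (gB (Bool ⊕ X)) = z⁻¹ * gB (Bool ⊕ X) * z := by simp [g]
  have gA'' : g (shift (gA X)) = z⁻¹ * shift (gA X) := by simp [g]
  have gB'' : g (shift (gB X)) = shift (gB X) := by simp [g]
  have gs : ∀ w : FreeGroup X, g (shift (shift w)) = shift (shift w) := by simp [g]
  have ext3 : ∀ h : FreeGroup (Bool ⊕ (Bool ⊕ X)) →* FreeGroup (Bool ⊕ (Bool ⊕ X)),
      h (shift (gA X)) = shift (gA X) → h (shift (gB X)) = shift (gB X) →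
      (∀ w : FreeGroup X, h (shift (shift w)) = shift (shift w)) → ∀ w, h (shift w) = shift w :=
    fun h h1 h2 h3 w => DFunLike.congr_fun
      (handle_hom_ext (f := h.comp shift) (g := shift) h1 h2 h3) w
  clear_value f g
  obtain ⟨α, hα⟩ := exists_handle_aut f g
    (by simp [gA', fA, hf]) (by simp [gB', fB, hf, mul_assoc])
    (ext3 (f.comp g) (by simp [gA'', fA', hf]) (by simp [gB'', fB']) (by simp [gs, fs]))
    (by simp [gA', fA, hg]) (by simp [gB', fB, hg, mul_assoc])
    (ext3 (g.comp f) (by simp [gA'', fA', hg]) (by simp [gB'', fB']) (by simp [gs, fs]))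
  exact ⟨α, by rw [hα, hf], by rw [hα, fA], by rw [hα, fB], by rw [hα, fA'], by rw [hα, fB'],
    fun w => by rw [hα, fs]⟩

end Handles

section Handles

open scoped commutatorElement

theorem handle_commute {Y H : Type*} [Group H] (f : FreeGroup (Bool ⊕ Y) →* H) {h : H}
    (ha : Commute (f (gA Y)) h) (hb : Commute (f (gB Y)) h)
    (hs : ∀ w, Commute (f (shift w)) h) (u : FreeGroup (Bool ⊕ Y)) : Commute (f u) h := by
  have key : ∀ x : H, Commute x h ↔ x = h * x * h⁻¹ := fun x => by
    rw [eq_mul_inv_iff_mul_eq, commute_iff_eq]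
  have : f = (MulAut.conj h).toMonoidHom.comp f :=
    handle_hom_ext ((key _).1 ha) ((key _).1 hb) fun w => (key _).1 (hs w)
  exact (key _).2 (DFunLike.congr_fun this u)

/-- The first handle together with the word `c` on the remaining generators. -/
def addHandle {Y : Type*} (c : FreeGroup Y) : FreeGroup (Bool ⊕ Y) := ⁅gA Y, gB Y⁆ * shift c

theorem exists_aut_swap_fixing {X : Type*} (c : FreeGroup X) :
    ∃ α : MulAut (FreeGroup (Bool ⊕ (Bool ⊕ X))),
      α (addHandle (addHandle c)) = addHandle (addHandle c) ∧
      α ⁅gA (Bool ⊕ X), gB (Bool ⊕ X)⁆ = ⁅gA (Bool ⊕ X), gB (Bool ⊕ X)⁆ *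
        shift ⁅gA X, gB X⁆ * ⁅gA (Bool ⊕ X), gB (Bool ⊕ X)⁆⁻¹ ∧
      α (shift (gA X)) = gA (Bool ⊕ X) ∧ α (shift (gB X)) = gB (Bool ⊕ X) ∧
      ∀ w : FreeGroup X, α (shift (shift w)) = shift (shift w) := by
  obtain ⟨α, h1, h2, h3, h4, h5⟩ := exists_aut_swap X
  have h6 : α ⁅gA (Bool ⊕ X), gB (Bool ⊕ X)⁆ = ⁅gA (Bool ⊕ X), gB (Bool ⊕ X)⁆ *
        shift ⁅gA X, gB X⁆ * ⁅gA (Bool ⊕ X), gB (Bool ⊕ X)⁆⁻¹ := by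
    rw [map_commutatorElement, map_commutatorElement, h1, h2, conjugate_commutatorElement]
  refine ⟨α, ?_, h6, h3, h4, h5⟩
  simp only [addHandle, map_mul, h5, h6]
  rw [map_commutatorElement shift, map_commutatorElement α, h3, h4]
  group

theorem exists_aut_twist_fixing {X : Type*} (c : FreeGroup X)
    {z : FreeGroup (Bool ⊕ (Bool ⊕ X))}
    (hz : z = (gB (Bool ⊕ X))⁻¹ * (shift (gA X) * shift (gB X) * (shift (gA X))⁻¹)) :
    ∃ α : MulAut (FreeGroup (Bool ⊕ (Bool ⊕ X))),
      α (addHandle (addHandle c)) = addHandle (addHandle c) ∧ α z = z ∧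
      α ⁅gA (Bool ⊕ X), gB (Bool ⊕ X)⁆ = ⁅gA (Bool ⊕ X), gB (Bool ⊕ X)⁆ * ⁅gB (Bool ⊕ X), z⁆ ∧
      α (gB (Bool ⊕ X)) = z * gB (Bool ⊕ X) * z⁻¹ ∧
      α (shift (gA X)) = z * shift (gA X) := by
  obtain ⟨α, h1, h2, h3, h4, h5, h6⟩ := exists_aut_twist X z hz
  have h7 : α ⁅gA (Bool ⊕ X), gB (Bool ⊕ X)⁆ =
      ⁅gA (Bool ⊕ X), gB (Bool ⊕ X)⁆ * ⁅gB (Bool ⊕ X), z⁆ := by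
    rw [map_commutatorElement, h2, h3]
    simp only [commutatorElement_def]
    group
  refine ⟨α, ?_, h1, h7, h3, h4⟩
  simp only [addHandle, map_mul, h6, h7]
  rw [map_commutatorElement shift, map_commutatorElement α, h4, h5]
  have e : shift (gA X) * shift (gB X) * (shift (gA X))⁻¹ = gB (Bool ⊕ X) * z := by rw [hz]; group
  have e1 : ⁅shift (gA X), shift (gB X)⁆ = gB (Bool ⊕ X) * z * (shift (gB X))⁻¹ := by
    rw [← e, commutatorElement_def]
  have e2 : ⁅z * shift (gA X), shift (gB X)⁆ =
      z * (gB (Bool ⊕ X) * z) * z⁻¹ * (shift (gB X))⁻¹ := by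
    rw [← e, commutatorElement_def]
    group
  rw [e1, e2, commutatorElement_def (gB (Bool ⊕ X))]
  group

theorem exists_aut_transvection_fixing {Y : Type*} (c : FreeGroup Y) :
    ∃ α : MulAut (FreeGroup (Bool ⊕ Y)), α (addHandle c) = addHandle c ∧ α (gA Y) = gA Y ∧
      α (gB Y) = gB Y * gA Y ∧ α ⁅gA Y, gB Y⁆ = ⁅gA Y, gB Y⁆ ∧
      ∀ w, α (shift w) = shift w := by
  obtain ⟨α, h1, h2, h3⟩ := exists_aut_transvection Y
  have h4 : α ⁅gA Y, gB Y⁆ = ⁅gA Y, gB Y⁆ := by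
    rw [map_commutatorElement, h1, h2]
    simp only [commutatorElement_def]
    group
  exact ⟨α, by rw [addHandle, map_mul, h3, h4], h1, h2, h4, h3⟩

theorem exists_aut_extend_fixing {Y : Type*} {c : FreeGroup Y} (β : MulAut (FreeGroup Y))
    (hβ : β c = c) :
    ∃ α : MulAut (FreeGroup (Bool ⊕ Y)), α (addHandle c) = addHandle c ∧ α (gA Y) = gA Y ∧
      α (gB Y) = gB Y ∧ α ⁅gA Y, gB Y⁆ = ⁅gA Y, gB Y⁆ ∧
      ∀ w, α (shift w) = shift (β w) := by
  obtain ⟨α, h1, h2, h3⟩ := exists_aut_extend β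
  have h4 : α ⁅gA Y, gB Y⁆ = ⁅gA Y, gB Y⁆ := by
    rw [map_commutatorElement, h1, h2]
  exact ⟨α, by rw [addHandle, map_mul, h3, h4, hβ], h1, h2, h4, h3⟩

/-- Morphisms to `H` with non-abelian image can be precomposed by an automorphism fixing the
boundary word so as not to kill the boundary of the first handle. -/
def HandleSurvives {Y : Type*} (c : FreeGroup Y) (H : Type*) [Group H] : Prop :=
  ∀ φ : FreeGroup (Bool ⊕ Y) →* H, (∃ u v, ¬Commute (φ u) (φ v)) →
    ∃ β : MulAut (FreeGroup (Bool ⊕ Y)), β (addHandle c) = addHandle c ∧ φ (β ⁅gA Y, gB Y⁆) ≠ 1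

theorem handleSurvives_of_isEmpty {Y : Type*} [IsEmpty Y] (c : FreeGroup Y) (H : Type*) [Group H] :
    HandleSurvives c H := by
  rintro φ ⟨u, v, huv⟩
  refine ⟨1, rfl, fun h => huv ?_⟩
  rw [MulAut.one_apply, map_commutatorElement, commutatorElement_eq_one_iff_commute] at h
  have hs : ∀ (w : FreeGroup Y) h, Commute (φ (shift w)) h := fun w h => by
    rw [Subsingleton.elim w 1, map_one, map_one]
    exact Commute.one_left h
  exact handle_commute φ (handle_commute φ (Commute.refl _) h.symm (fun w => hs w _) v).symm
    (handle_commute φ h (Commute.refl _) (fun w => hs w _) v).symm (fun w => hs w _) u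

theorem handleSurvives_addHandle {X : Type*} {c : FreeGroup X} {H : Type*} [Group H]
    (ih : HandleSurvives c H) : HandleSurvives (addHandle c) H := by
  rintro φ ⟨u, v, huv⟩
  by_contra! hcon
  apply huv
  have hab : ∀ β : MulAut (FreeGroup (Bool ⊕ (Bool ⊕ X))),
      β (addHandle (addHandle c)) = addHandle (addHandle c) →
      Commute (φ (β (gA (Bool ⊕ X)))) (φ (β (gB (Bool ⊕ X)))) := by
    intro β hβ
    have := hcon β hβ
    rwa [map_commutatorElement, map_commutatorElement, commutatorElement_eq_one_iff_commute] at this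
  obtain ⟨σ, σc, σc1, σa, σb, σs⟩ := exists_aut_swap_fixing c
  have hrest : ∀ β : MulAut (FreeGroup (Bool ⊕ (Bool ⊕ X))),
      β (addHandle (addHandle c)) = addHandle (addHandle c) →
      ∀ v w, Commute (φ (β (shift v))) (φ (β (shift w))) := by
    intro β hβ v w
    by_contra h
    obtain ⟨β', h1, h2⟩ := ih ((φ.comp β.toMonoidHom).comp shift) ⟨v, w, h⟩
    obtain ⟨ε, ε1, ε2, ε3, ε4, ε5⟩ := exists_aut_extend_fixing β' h1
    have := hcon (β * ε * σ) (by simp only [MulAut.mul_apply, σc, ε1, hβ])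
    simp only [MulAut.mul_apply, σc1, map_mul, map_inv, ε4, ε5] at this
    rw [conj_eq_one_iff] at this
    exact h2 this
  obtain ⟨τ, τc, -, τc1, -, -⟩ := exists_aut_twist_fixing c rfl
  have hbb : ∀ β : MulAut (FreeGroup (Bool ⊕ (Bool ⊕ X))),
      β (addHandle (addHandle c)) = addHandle (addHandle c) →
      Commute (φ (β (gB (Bool ⊕ X)))) (φ (β (shift (gB X)))) := by
    intro β hβ
    have h1 := hcon (β * τ) (by simp only [MulAut.mul_apply, τc, hβ])
    simp only [MulAut.mul_apply, τc1, map_mul, hcon β hβ, one_mul] at h1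
    rw [map_commutatorElement, map_commutatorElement, commutatorElement_eq_one_iff_commute] at h1
    simp only [map_mul, map_inv] at h1
    have h2 := (hrest β hβ (gA X) (gB X)).eq
    rw [h2, mul_inv_cancel_right] at h1
    simpa using (Commute.refl _).mul_right h1
  obtain ⟨t, tc, ta, tb, -, ts⟩ := exists_aut_transvection_fixing (addHandle c)
  have hAB : ∀ β : MulAut (FreeGroup (Bool ⊕ (Bool ⊕ X))),
      β (addHandle (addHandle c)) = addHandle (addHandle c) →
      Commute (φ (β (gA (Bool ⊕ X)))) (φ (β (shift (gB X)))) := by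
    intro β hβ
    have h1 := hbb (β * t) (by simp only [MulAut.mul_apply, tc, hβ])
    simp only [MulAut.mul_apply, tb, ts, map_mul] at h1
    simpa using (hbb β hβ).inv_left.mul_left h1
  obtain ⟨t', tc', ta', tb', -, ts'⟩ := exists_aut_transvection_fixing c
  obtain ⟨s, sc, sa, sb, -, ss⟩ := exists_aut_extend_fixing t' tc'
  have hBA : Commute (φ (gB (Bool ⊕ X))) (φ (shift (gA X))) := by
    have h1 := hbb s sc
    simp only [sb, ss, tb', map_mul] at h1
    simpa using (hbb 1 rfl).inv_right.mul_right h1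
  have hAA : Commute (φ (gA (Bool ⊕ X))) (φ (shift (gA X))) := by
    have h1 := hAB s sc
    simp only [sa, ss, tb', map_mul] at h1
    simpa using (hAB 1 rfl).inv_right.mul_right h1
  have hs : ∀ (x : FreeGroup (Bool ⊕ X)) (w : FreeGroup X),
      Commute (φ (σ (shift x))) (φ (shift (shift w))) := fun x w => by
    have := hrest σ σc x (shift w)
    rwa [σs] at this
  have hAs : ∀ w, Commute (φ (shift w)) (φ (gA (Bool ⊕ X))) := by
    refine handle_commute (φ.comp shift) hAA.symm (hAB 1 rfl).symm fun w => ?_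
    have := hs (gA X) w
    rw [σa] at this
    exact this.symm
  have hBs : ∀ w, Commute (φ (shift w)) (φ (gB (Bool ⊕ X))) := by
    refine handle_commute (φ.comp shift) hBA.symm (hbb 1 rfl).symm fun w => ?_
    have := hs (gB X) w
    rw [σb] at this
    exact this.symm
  have h1 := hab 1 rfl
  refine handle_commute φ ?_ ?_ (fun w => ?_) u
  · exact (handle_commute φ (Commute.refl _) h1.symm hAs v).symm
  · exact (handle_commute φ h1 (Commute.refl _) hBs v).symm
  · exact (handle_commute φ (hAs w).symm (hBs w).symm (fun w' => hrest 1 rfl w' w) v).symm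

/-- The boundary of the first handle can be made not to commute with the boundary word. -/
theorem HandleSurvives.exists_not_commute {X ι : Type*} {c : FreeGroup X}
    (h : HandleSurvives (addHandle c) (FreeGroup ι))
    (φ : FreeGroup (Bool ⊕ (Bool ⊕ X)) →* FreeGroup ι) (hna : ∃ u v, ¬Commute (φ u) (φ v))
    (hφ : φ (addHandle (addHandle c)) ≠ 1) :
    ∃ β : MulAut (FreeGroup (Bool ⊕ (Bool ⊕ X))),
      β (addHandle (addHandle c)) = addHandle (addHandle c) ∧
      ¬Commute (φ (β ⁅gA (Bool ⊕ X), gB (Bool ⊕ X)⁆))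
        (φ (addHandle (addHandle c))) := by
  obtain ⟨β, hβ, hβ1⟩ := h φ hna
  by_contra! hcon
  set C := φ (addHandle (addHandle c)) with hC
  obtain ⟨z, hz⟩ : ∃ z : FreeGroup (Bool ⊕ (Bool ⊕ X)), z = (gB (Bool ⊕ X))⁻¹ *
    (shift (gA X) * shift (gB X) * (shift (gA X))⁻¹) := ⟨_, rfl⟩
  obtain ⟨τ, τc, τz, τc1, τb, τa⟩ := exists_aut_twist_fixing c hz
  have hBz : ∀ β : MulAut (FreeGroup (Bool ⊕ (Bool ⊕ X))),
      β (addHandle (addHandle c)) = addHandle (addHandle c) →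
      Commute (φ (β (gB (Bool ⊕ X)))) (φ (β z)) := by
    intro β hβ
    have h0 := hcon β hβ
    have h1 := hcon (β * τ) (by simp only [MulAut.mul_apply, τc, hβ])
    have h2 := hcon (β * τ * τ) (by simp only [MulAut.mul_apply, τc, hβ])
    simp only [MulAut.mul_apply, τc1, map_mul] at h1 h2
    have h3 := h0.inv_left.mul_left h1
    rw [inv_mul_cancel_left] at h3
    have h4 := h1.inv_left.mul_left h2
    rw [inv_mul_cancel_left] at h4
    simp only [map_commutatorElement, τb, τz, map_mul, map_inv] at h3 h4
    set B := φ (β (gB (Bool ⊕ X)))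
    set Z := φ (β z)
    by_contra hBZ
    have hZ : Z ≠ 1 := by
      intro h
      rw [h] at hBZ
      exact hBZ (Commute.one_right B)
    have he : ⁅B, Z⁆ ≠ 1 := fun h => hBZ (commutatorElement_eq_one_iff_commute.1 h)
    have e4 : ⁅Z * B * Z⁻¹, Z⁆ = Z * ⁅B, Z⁆ * Z⁻¹ := by
      simp only [commutatorElement_def]; group
    rw [e4] at h4
    have h5 := FreeGroup.commute_of_commute_conj he (FreeGroup.commute_trans hφ h4 h3)
    apply hBZ
    apply FreeGroup.commute_of_commute_conj hZ
    have := h5.symm.mul_left (Commute.refl Z)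
    rwa [commutatorElement_def, inv_mul_cancel_right] at this
  have hBY : ∀ β : MulAut (FreeGroup (Bool ⊕ (Bool ⊕ X))),
      β (addHandle (addHandle c)) = addHandle (addHandle c) →
      Commute (φ (β (gB (Bool ⊕ X))))
        (φ (β (shift (gA X) * shift (gB X) * (shift (gA X))⁻¹))) := by
    intro β hβ
    have := hBz β hβ
    rw [hz, map_mul, map_mul, map_inv, map_inv] at this
    simpa using (Commute.refl _).mul_right this
  obtain ⟨t, tc, ta, tb, tc1, ts⟩ := exists_aut_transvection_fixing (addHandle c)
  have hb2 : ∀ β : MulAut (FreeGroup (Bool ⊕ (Bool ⊕ X))),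
      β (addHandle (addHandle c)) = addHandle (addHandle c) →
      φ (β ⁅gA (Bool ⊕ X), gB (Bool ⊕ X)⁆) ≠ 1 → φ (β (shift (gB X))) = 1 := by
    intro β hβ hβ1
    have h1 := hBY β hβ
    have h2 := hBY (β * t) (by simp only [MulAut.mul_apply, tc, hβ])
    rw [← map_mul, ← map_inv, ← map_mul] at h1 h2
    simp only [MulAut.mul_apply, tb, ts] at h2
    rw [map_mul, map_mul] at h2
    have h3 := h1.inv_left.mul_left h2
    rw [inv_mul_cancel_left] at h3
    by_contra hne
    apply hβ1
    rw [map_commutatorElement, map_commutatorElement, commutatorElement_eq_one_iff_commute]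
    refine FreeGroup.commute_trans ?_ h3 h1
    simpa [conj_eq_one_iff] using hne
  obtain ⟨t', tc', ta', tb', -, ts'⟩ := exists_aut_transvection_fixing c
  obtain ⟨s, sc, sa, sb, sc1, ss⟩ := exists_aut_extend_fixing t' tc'
  have ha2 : ∀ β : MulAut (FreeGroup (Bool ⊕ (Bool ⊕ X))),
      β (addHandle (addHandle c)) = addHandle (addHandle c) →
      φ (β ⁅gA (Bool ⊕ X), gB (Bool ⊕ X)⁆) ≠ 1 → φ (β (shift (gA X))) = 1 := by
    intro β hβ hβ1
    have h1 := hb2 (β * s) (by simp only [MulAut.mul_apply, sc, hβ])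
      (by rwa [MulAut.mul_apply, sc1])
    rw [MulAut.mul_apply, ss, tb', map_mul, map_mul, map_mul, hb2 β hβ hβ1, one_mul] at h1
    exact h1
  have h1 := ha2 (β * τ) (by simp only [MulAut.mul_apply, τc, hβ]) (by
    rw [MulAut.mul_apply, τc1, map_mul, map_mul, map_commutatorElement β (gB _),
      map_commutatorElement φ (β (gB _)), commutatorElement_eq_one_iff_commute.2 (hBz β hβ),
      mul_one]
    exact hβ1)
  rw [MulAut.mul_apply, τa, map_mul, map_mul, ha2 β hβ hβ1, mul_one, hz] at h1
  simp only [map_mul, map_inv, hb2 β hβ hβ1, ha2 β hβ hβ1] at h1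
  apply hβ1
  have hB : φ (β (gB (Bool ⊕ X))) = 1 := by simpa using h1
  rw [map_commutatorElement, map_commutatorElement, hB, commutatorElement_one_right]

end Handles

section Surfaces

open scoped commutatorElement

theorem mem_zpowers_of_commute_of_heisenberg {X : Type*} {r a : FreeGroup X}
    (θ : FreeGroup X →* Heisenberg) (h : θ r = ⟨0, 0, 1⟩) (ha : Commute a r) :
    a ∈ Subgroup.zpowers r := by
  refine mem_zpowers_of_commute ?_ (fun y k hk => ?_) ha
  · rintro rfl
    rw [map_one, Heisenberg.one_def] at h
    simp at h
  · rw [← hk, map_zpow] at h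
    exact Heisenberg.zpow_eq_central h

theorem Heisenberg.commutator_eq :
    ⁅(⟨1, 0, 0⟩ : Heisenberg), (⟨0, 1, 0⟩ : Heisenberg)⁆ = ⟨0, 0, 1⟩ := by
  simp [commutatorElement_def, Heisenberg.mul_def, Heisenberg.inv_def]

theorem mem_zpowers_addHandle {Y : Type*} {c : FreeGroup Y} {a : FreeGroup (Bool ⊕ Y)}
    (ha : Commute a (addHandle c)) : a ∈ Subgroup.zpowers (addHandle c) := by
  refine mem_zpowers_of_commute_of_heisenberg (handleLift ⟨1, 0, 0⟩ ⟨0, 1, 0⟩ 1) ?_ ha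
  simp [addHandle, map_commutatorElement, Heisenberg.commutator_eq]

/-- The commutator of the two generators of the free group of rank two. -/
def pairCommutator : FreeGroup Bool := ⁅FreeGroup.of true, FreeGroup.of false⁆

theorem mem_zpowers_pairCommutator {a : FreeGroup Bool} (ha : Commute a pairCommutator) :
    a ∈ Subgroup.zpowers pairCommutator := by
  refine mem_zpowers_of_commute_of_heisenberg
    (FreeGroup.lift fun i => bif i then ⟨1, 0, 0⟩ else ⟨0, 1, 0⟩) ?_ ha
  simp [pairCommutator, map_commutatorElement, Heisenberg.commutator_eq]

/-- The free group of rank two as the group of the first handle. -/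
def handleIncl (Y : Type*) : FreeGroup Bool →* FreeGroup (Bool ⊕ Y) := FreeGroup.map Sum.inl

@[simp] theorem handleIncl_true (Y : Type*) : handleIncl Y (FreeGroup.of true) = gA Y := by
  simp [handleIncl, gA]

@[simp] theorem handleIncl_false (Y : Type*) : handleIncl Y (FreeGroup.of false) = gB Y := by
  simp [handleIncl, gB]

theorem handleIncl_pairCommutator (Y : Type*) :
    handleIncl Y pairCommutator = ⁅gA Y, gB Y⁆ := by
  rw [pairCommutator, map_commutatorElement, handleIncl_true, handleIncl_false]

theorem injective_comp_handleIncl {Y ι : Type*} (φ : FreeGroup (Bool ⊕ Y) →* FreeGroup ι)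
    (h : φ ⁅gA Y, gB Y⁆ ≠ 1) : Function.Injective (φ.comp (handleIncl Y)) := by
  refine injective_of_not_commute _ fun hc => h ?_
  rw [map_commutatorElement, commutatorElement_eq_one_iff_commute]
  simpa using hc

theorem handle_subgroup_eq_top {Y : Type*} {S : Subgroup (FreeGroup (Bool ⊕ Y))}
    (hA : gA Y ∈ S) (hB : gB Y ∈ S) (hs : ∀ w, shift w ∈ S) : S = ⊤ := by
  rw [eq_top_iff, ← FreeGroup.closure_range_of, Subgroup.closure_le]
  rintro _ ⟨(_ | _) | y, rfl⟩
  · exact hB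
  · exact hA
  · simpa [shift] using hs (FreeGroup.of y)

theorem Separates.mono {G H : Type*} [Group G] [Group H] {X Z : Set G} {φ : G →* H} (hXZ : X ⊆ Z)
    (h : Separates Z φ) : Separates X φ := by
  obtain ⟨l, hl, h1, h2⟩ := h
  exact ⟨l, hl, h1.mono fun α hα x hx => hα x (hXZ hx), h2⟩

/-- The inclusion of the group of a pair of pants in that of a torus with two holes. -/
def pantsIncl : FreeGroup Bool →* FreeGroup (Bool ⊕ Unit) :=
  FreeGroup.lift fun i => bif i then ⁅gA Unit, gB Unit⁆ else shift (FreeGroup.of ())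

theorem separates_range_pantsIncl {ι : Type*} (φ : FreeGroup (Bool ⊕ Unit) →* FreeGroup ι)
    (h : ¬Commute (φ ⁅gA Unit, gB Unit⁆) (φ (shift (FreeGroup.of ())))) :
    Separates (Set.range pantsIncl) φ := by
  have htrue : pantsIncl (FreeGroup.of true) = ⁅gA Unit, gB Unit⁆ := by simp [pantsIncl]
  have hfalse : pantsIncl (FreeGroup.of false) = shift (FreeGroup.of ()) := by simp [pantsIncl]
  have h1 : φ ⁅gA Unit, gB Unit⁆ ≠ 1 := fun h1 => h (h1 ▸ Commute.one_left _)
  rw [← Set.image_univ]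
  refine Separates.amalgam pantsIncl (handleIncl Unit) (cA := FreeGroup.of true)
    (cB := pairCommutator) (by rw [htrue, handleIncl_pairCommutator]) ?_ ?_
    (fun a => mem_zpowers_of_commute_of true)
    (fun _ => mem_zpowers_pairCommutator) φ (by rwa [htrue]) ?_ ?_
  · intro fA fB hf
    refine ⟨handleLift (fB (FreeGroup.of true)) (fB (FreeGroup.of false))
      (FreeGroup.lift fun _ => fA (FreeGroup.of false)), fun a => ?_, fun b => ?_⟩
    · rw [← MonoidHom.comp_apply]
      congr 1
      refine FreeGroup.ext_hom _ _ ?_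
      rintro (_ | _)
      · simp [hfalse]
      · simp [htrue, hf, map_commutatorElement, pairCommutator]
    · rw [← MonoidHom.comp_apply]
      congr 1
      refine FreeGroup.ext_hom _ _ ?_
      rintro (_ | _) <;> simp
  · refine handle_subgroup_eq_top
      (Subgroup.subset_closure (Or.inr ⟨_, handleIncl_true _⟩))
      (Subgroup.subset_closure (Or.inr ⟨_, handleIncl_false _⟩)) fun w => ?_
    suffices (⊤ : Subgroup (FreeGroup Unit)) ≤ Subgroup.comap shift
      (Subgroup.closure (Set.range pantsIncl ∪ Set.range (handleIncl Unit))) from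
        this (Subgroup.mem_top w)
    rw [← FreeGroup.closure_range_of, Subgroup.closure_le]
    rintro _ ⟨⟨⟩, rfl⟩
    exact Subgroup.subset_closure (Or.inl ⟨_, hfalse⟩)
  · exact separates_of_injective _ (injective_of_not_commute _ (by simpa [htrue, hfalse] using h))
  · exact separates_of_injective _ (injective_comp_handleIncl _ h1)

theorem separates_addHandle {Y ι : Type*} {d : FreeGroup Y}
    (hd : ∀ a, Commute a d → a ∈ Subgroup.zpowers d)
    (φ : FreeGroup (Bool ⊕ Y) →* FreeGroup ι)
    (h : ¬Commute (φ ⁅gA Y, gB Y⁆) (φ (shift d)))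
    (ih : Separates {d} (φ.comp shift)) : Separates {addHandle d} φ := by
  let i : FreeGroup (Bool ⊕ Unit) →* FreeGroup (Bool ⊕ Y) :=
    handleLift (gA Y) (gB Y) (FreeGroup.lift fun _ => shift d)
  have iA : i (gA Unit) = gA Y := by simp [i]
  have iB : i (gB Unit) = gB Y := by simp [i]
  have is : i (shift (FreeGroup.of ())) = shift d := by simp [i]
  have hX : i '' {⁅gA Unit, gB Unit⁆ * shift (FreeGroup.of ())} = {addHandle d} := by
    rw [Set.image_singleton, map_mul, map_commutatorElement, iA, iB, is, addHandle]
  rw [← hX]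
  refine Separates.amalgam i shift (cA := shift (FreeGroup.of ())) (cB := d) is ?_ ?_
    (fun a ha => ?_) hd φ ?_ ?_ ih
  · intro fA fB hf
    refine ⟨handleLift (fA (gA Unit)) (fA (gB Unit)) fB, fun a => ?_, fun b => ?_⟩
    · rw [← MonoidHom.comp_apply]
      congr 1
      refine handle_hom_ext ?_ ?_ fun w => ?_
      · simp [iA]
      · simp [iB]
      · rw [← MonoidHom.comp_apply, ← MonoidHom.comp_apply]
        congr 1
        exact FreeGroup.ext_hom _ _ fun _ => by simp [is, hf]
    · simp
  · exact handle_subgroup_eq_top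
      (Subgroup.subset_closure (Or.inl ⟨_, iA⟩))
      (Subgroup.subset_closure (Or.inl ⟨_, iB⟩)) fun w =>
        Subgroup.subset_closure (Or.inr ⟨w, rfl⟩)
  · have e : shift (FreeGroup.of ()) = FreeGroup.of (Sum.inr () : Bool ⊕ Unit) := by simp [shift]
    rw [e] at ha ⊢
    exact mem_zpowers_of_commute_of _ ha
  · intro h1
    rw [is] at h1
    exact h (h1 ▸ Commute.one_right _)
  · refine Separates.mono ?_ (separates_range_pantsIncl _ ?_)
    · rintro _ (rfl | rfl)
      · exact ⟨FreeGroup.of false, by simp [pantsIncl]⟩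
      · exact ⟨FreeGroup.of true * FreeGroup.of false, by simp [pantsIncl]⟩
    · simpa [map_commutatorElement, iA, iB, is] using h

theorem separates_addHandle_of_isEmpty {Y ι : Type*} [IsEmpty Y] (c : FreeGroup Y)
    (φ : FreeGroup (Bool ⊕ Y) →* FreeGroup ι) (h : φ (addHandle c) ≠ 1) :
    Separates {addHandle c} φ := by
  rw [addHandle, Subsingleton.elim c 1, map_one, mul_one] at h
  refine separates_of_injective _ ?_
  have hinj := injective_comp_handleIncl φ h
  have hsurj : Function.Surjective (handleIncl Y) := by
    rw [← MonoidHom.range_eq_top]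
    refine handle_subgroup_eq_top ⟨_, handleIncl_true _⟩ ⟨_, handleIncl_false _⟩ fun w => ?_
    rw [Subsingleton.elim w 1, map_one]
    exact one_mem _
  intro x y hxy
  obtain ⟨x, rfl⟩ := hsurj x
  obtain ⟨y, rfl⟩ := hsurj y
  rw [hinj hxy]

/-- An index type for the standard generators of a surface group of genus `h`. -/
def Handles : ℕ → Type
  | 0 => Empty
  | h + 1 => Bool ⊕ Handles h

/-- The boundary word of the surface of genus `h` with one boundary component. -/
def boundaryWord : ∀ h : ℕ, FreeGroup (Handles h)
  | 0 => 1
  | h + 1 => addHandle (boundaryWord h)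

theorem handleSurvives_boundaryWord (H : Type*) [Group H] :
    ∀ h : ℕ, HandleSurvives (boundaryWord h) H
  | 0 => haveI : IsEmpty (Handles 0) := inferInstanceAs (IsEmpty Empty)
    handleSurvives_of_isEmpty _ H
  | h + 1 => handleSurvives_addHandle (handleSurvives_boundaryWord H h)

theorem map_boundaryWord_eq_one {H : Type*} [Group H] :
    ∀ (h : ℕ) (φ : FreeGroup (Handles h) →* H), (∀ u v, Commute (φ u) (φ v)) →
      φ (boundaryWord h) = 1
  | 0, φ, _ => map_one φ
  | h + 1, φ, hφ => by
    have h1 : ∀ (c : FreeGroup (Handles h)) (φ : FreeGroup (Bool ⊕ Handles h) →* H),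
        (∀ u v, Commute (φ u) (φ v)) → φ (shift c) = 1 → φ (addHandle c) = 1 := by
      intro c φ hφ hc
      rw [addHandle, map_mul, hc, mul_one, map_commutatorElement,
        commutatorElement_eq_one_iff_commute]
      exact hφ _ _
    exact h1 _ φ hφ (map_boundaryWord_eq_one h (φ.comp shift) fun u v => hφ _ _)

theorem separates_addHandle_addHandle {X ι : Type*} {c : FreeGroup X}
    (hs : HandleSurvives (addHandle c) (FreeGroup ι))
    (ih : ∀ φ : FreeGroup (Bool ⊕ X) →* FreeGroup ι, φ (addHandle c) ≠ 1 →
      Separates {addHandle c} φ)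
    (φ : FreeGroup (Bool ⊕ (Bool ⊕ X)) →* FreeGroup ι) (hna : ∃ u v, ¬Commute (φ u) (φ v))
    (hφ : φ (addHandle (addHandle c)) ≠ 1) : Separates {addHandle (addHandle c)} φ := by
  obtain ⟨β, hβ, hβ1⟩ := hs.exists_not_commute φ hna hφ
  have hne : ¬Commute (φ.comp β.toMonoidHom ⁅gA (Bool ⊕ X), gB (Bool ⊕ X)⁆)
      (φ.comp β.toMonoidHom (shift (addHandle c))) := by
    intro hcon
    apply hβ1
    have h2 := (Commute.refl _).mul_right hcon
    rw [← map_mul] at h2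
    have h3 : φ.comp β.toMonoidHom (addHandle (addHandle c)) = φ (addHandle (addHandle c)) :=
      congrArg φ hβ
    rw [← h3]
    exact h2
  refine Separates.precomp β (by rintro _ rfl; exact hβ) ?_
  exact separates_addHandle (fun _ => mem_zpowers_addHandle) _ hne
    (ih _ fun h => hne (by
      rw [MonoidHom.comp_apply] at h
      rw [h]
      exact Commute.one_right _))

theorem separates_boundaryWord {ι : Type*} :
    ∀ (h : ℕ) (φ : FreeGroup (Handles h) →* FreeGroup ι), φ (boundaryWord h) ≠ 1 →
      Separates {boundaryWord h} φ
  | 0, φ, hφ => absurd (map_one φ) hφ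
  | 1, φ, hφ => haveI : IsEmpty (Handles 0) := inferInstanceAs (IsEmpty Empty)
    separates_addHandle_of_isEmpty (boundaryWord 0) φ hφ
  | h + 2, φ, hφ => by
    refine separates_addHandle_addHandle (handleSurvives_boundaryWord _ (h + 1))
      (separates_boundaryWord (h + 1)) φ ?_ hφ
    by_contra! hcon
    exact hφ (map_boundaryWord_eq_one (h + 2) φ hcon)

end Surfaces

section Closed

open scoped commutatorElement

/-- The closed case: `q` presents `G` by the single relator `addHandle d`. -/
theorem separates_closed {Y G ι : Type*} [Group G] {d : FreeGroup Y}
    (q : FreeGroup (Bool ⊕ Y) →* G) (hq : Function.Surjective q) (hqd : q (addHandle d) = 1)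
    (hlift : ∀ f : FreeGroup (Bool ⊕ Y) →* G, f (addHandle d) = 1 → ∃ f' : G →* G, f'.comp q = f)
    (hd : ∀ a, Commute a d → a ∈ Subgroup.zpowers d)
    (hs : HandleSurvives d (FreeGroup ι))
    (ih : ∀ φ : FreeGroup Y →* FreeGroup ι, φ d ≠ 1 → Separates {d} φ)
    (φ : G →* FreeGroup ι) (hna : ∃ u v, ¬Commute (φ u) (φ v)) : Separates ∅ φ := by
  obtain ⟨β, hβ, hβ1⟩ := hs (φ.comp q) (by
    obtain ⟨u, v, h⟩ := hna
    obtain ⟨u, rfl⟩ := hq u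
    obtain ⟨v, rfl⟩ := hq v
    exact ⟨u, v, h⟩)
  have hβ' : β⁻¹ (addHandle d) = addHandle d := by
    conv_lhs => rw [← hβ]
    exact MulAut.inv_apply_self _ _ _
  obtain ⟨f, hf⟩ := hlift (q.comp β.toMonoidHom) ((congrArg q hβ).trans hqd)
  obtain ⟨f', hf'⟩ := hlift (q.comp β⁻¹.toMonoidHom) ((congrArg q hβ').trans hqd)
  have e1 : ∀ w, f (q w) = q (β w) := fun w => DFunLike.congr_fun hf w
  have e2 : ∀ w, f' (q w) = q (β⁻¹ w) := fun w => DFunLike.congr_fun hf' w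
  let γ : MulAut G := MonoidHom.toMulEquiv f f'
    (MonoidHom.ext fun x => by
      obtain ⟨w, rfl⟩ := hq x
      simp [e1, e2])
    (MonoidHom.ext fun x => by
      obtain ⟨w, rfl⟩ := hq x
      simp [e1, e2])
  have hγ : ∀ w, γ (q w) = q (β w) := e1
  refine Separates.precomp γ (by simp) ?_
  set ψ := φ.comp γ.toMonoidHom
  have hψ : ψ (q ⁅gA Y, gB Y⁆) ≠ 1 := by
    have : ψ (q ⁅gA Y, gB Y⁆) = φ (q (β ⁅gA Y, gB Y⁆)) := congrArg φ (hγ _)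
    rw [this]
    exact hβ1
  have hc : q ⁅gA Y, gB Y⁆ = q (shift d⁻¹) := by
    rw [addHandle, map_mul] at hqd
    rw [map_inv, map_inv]
    exact eq_inv_of_mul_eq_one_left hqd
  rw [← Set.image_empty (q.comp (handleIncl Y))]
  refine Separates.amalgam (q.comp (handleIncl Y)) (q.comp shift) (cA := pairCommutator)
    (cB := d⁻¹) ?_ ?_ ?_ (fun _ => mem_zpowers_pairCommutator) (fun b hb => ?_) ψ ?_ ?_ ?_
  · rw [MonoidHom.comp_apply, handleIncl_pairCommutator, hc, MonoidHom.comp_apply]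
  · intro fA fB hf
    obtain ⟨f, hf⟩ := hlift
      (handleLift (fA (FreeGroup.of true)) (fA (FreeGroup.of false)) fB) (by
        rw [addHandle, map_mul, map_commutatorElement, handleLift_gA, handleLift_gB,
          handleLift_shift, ← map_commutatorElement]
        exact mul_eq_one_iff_eq_inv.2 (hf.trans (map_inv _ _)))
    refine ⟨f, fun a => ?_, fun b => ?_⟩
    · rw [MonoidHom.comp_apply, ← MonoidHom.comp_apply, hf, ← MonoidHom.comp_apply]
      congr 1
      refine FreeGroup.ext_hom _ _ ?_
      rintro (_ | _) <;> simp
    · rw [MonoidHom.comp_apply, ← MonoidHom.comp_apply, hf, handleLift_shift]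
  · have h : Subgroup.comap q (Subgroup.closure
        (Set.range (q.comp (handleIncl Y)) ∪ Set.range (q.comp shift))) = ⊤ :=
      handle_subgroup_eq_top
        (Subgroup.subset_closure (Or.inl ⟨FreeGroup.of true, by simp⟩))
        (Subgroup.subset_closure (Or.inl ⟨FreeGroup.of false, by simp⟩)) fun w =>
          Subgroup.subset_closure (Or.inr ⟨w, rfl⟩)
    rw [eq_top_iff]
    intro x _
    obtain ⟨w, rfl⟩ := hq x
    exact Subgroup.mem_comap.1 (h ▸ Subgroup.mem_top w)
  · rw [Subgroup.zpowers_inv]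
    exact hd b (inv_inv d ▸ hb.inv_right)
  · have : q.comp (handleIncl Y) pairCommutator = q ⁅gA Y, gB Y⁆ := by
      rw [MonoidHom.comp_apply, handleIncl_pairCommutator]
    rwa [this]
  · exact separates_of_injective _ (injective_comp_handleIncl (ψ.comp q) hψ)
  · have h1 : (ψ.comp (q.comp shift)) d ≠ 1 := by
      intro h
      apply hψ
      rw [hc, map_inv, map_inv, map_inv]
      exact inv_eq_one.2 h
    obtain ⟨l, hl, h2, h3⟩ := ih _ h1
    refine ⟨l, hl, h2.mono fun α hα x hx => ?_, h3⟩
    rw [Set.mem_singleton_iff.1 hx, map_inv, hα d rfl]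

theorem exists_handles_equiv :
    ∀ g : ℕ, ∃ e : Handles g ≃ Fin g ⊕ Fin g,
      FreeGroup.map e (boundaryWord g) = (List.ofFn fun i : Fin g =>
        FreeGroup.of (Sum.inl i) * FreeGroup.of (Sum.inr i) *
          (FreeGroup.of (Sum.inl i))⁻¹ * (FreeGroup.of (Sum.inr i))⁻¹).prod
  | 0 => ⟨Equiv.equivOfIsEmpty Empty (Fin 0 ⊕ Fin 0), by simp [boundaryWord]⟩
  | g + 1 => by
    obtain ⟨e, he⟩ := exists_handles_equiv g
    let f : Bool ⊕ Handles g → Fin (g + 1) ⊕ Fin (g + 1) :=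
      Sum.elim (fun i => bif i then Sum.inl 0 else Sum.inr 0)
        (Sum.map Fin.succ Fin.succ ∘ e)
    have hf : Function.Bijective f := by
      have hinj : Function.Injective (Sum.map Fin.succ Fin.succ ∘ e :
          Handles g → Fin (g + 1) ⊕ Fin (g + 1)) :=
        (Function.Injective.sumMap (Fin.succ_injective g) (Fin.succ_injective g)).comp e.injective
      constructor
      · refine Function.Injective.sumElim ?_ hinj ?_
        · rintro (_ | _) (_ | _) <;> simp
        · intro i y
          rcases h : e y with j | j <;> cases i <;> simp [h, (Fin.succ_ne_zero j).symm]
      · rintro (i | i)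
        · refine Fin.cases ⟨Sum.inl true, rfl⟩ (fun j => ⟨Sum.inr (e.symm (Sum.inl j)), ?_⟩) i
          simp [f]
        · refine Fin.cases ⟨Sum.inl false, rfl⟩ (fun j => ⟨Sum.inr (e.symm (Sum.inr j)), ?_⟩) i
          simp [f]
    refine ⟨Equiv.ofBijective f hf, ?_⟩
    have hs : ∀ w : FreeGroup (Handles g), FreeGroup.map f (shift w) =
        FreeGroup.map (Sum.map Fin.succ Fin.succ) (FreeGroup.map e w) := fun w => by
      rw [shift, FreeGroup.map.comp, FreeGroup.map.comp]
      rfl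
    change FreeGroup.map f (addHandle (boundaryWord g)) = _
    rw [addHandle, map_mul, hs, he, map_list_prod, List.map_ofFn, map_commutatorElement]
    rw [List.ofFn_succ, List.prod_cons]
    simp [gA, gB, f, commutatorElement_def, Function.comp_def]

theorem finite_surfaceGens (g : ℕ) : (surfaceGens g).Finite := by
  have : surfaceGens g ⊆ ⋃ i : Fin g, {PresentedGroup.of (Sum.inl i),
      PresentedGroup.of (Sum.inr i), (PresentedGroup.of (Sum.inl i) : SurfaceGroup g)⁻¹,
      (PresentedGroup.of (Sum.inr i) : SurfaceGroup g)⁻¹} := by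
    rintro x ⟨i, h⟩
    exact Set.mem_iUnion.2 ⟨i, by simpa using h⟩
  exact (Set.finite_iUnion fun i => Set.toFinite _).subset this

theorem finite_cayleyBall (g n : ℕ) : (cayleyBall g n).Finite := by
  have := (finite_surfaceGens g).to_subtype
  refine ((List.finite_length_le (surfaceGens g) n).image
    fun l => (l.map Subtype.val).prod).subset ?_
  rintro _ ⟨l, hl, hl', rfl⟩
  lift l to List (surfaceGens g) using hl'
  exact ⟨l, by simpa using hl, rfl⟩

theorem exists_lift_surfaceGroup {Z H : Type*} [Group H] {g : ℕ} (e : Z ≃ Fin g ⊕ Fin g)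
    {w : FreeGroup Z} (hw : FreeGroup.map e w = (List.ofFn fun i : Fin g =>
      FreeGroup.of (Sum.inl i) * FreeGroup.of (Sum.inr i) *
        (FreeGroup.of (Sum.inl i))⁻¹ * (FreeGroup.of (Sum.inr i))⁻¹).prod)
    (f : FreeGroup Z →* H) (hf : f w = 1) :
    ∃ f' : SurfaceGroup g →* H,
      f'.comp ((PresentedGroup.mk (surfaceRel g)).comp (FreeGroup.map e)) = f := by
  have hf' : (FreeGroup.lift fun x => f (FreeGroup.of (e.symm x))).comp (FreeGroup.map e) = f :=
    FreeGroup.ext_hom _ _ fun x => by simp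
  refine ⟨PresentedGroup.toGroup (f := fun x => f (FreeGroup.of (e.symm x))) ?_, ?_⟩
  · rintro _ rfl
    rw [← hw, ← MonoidHom.comp_apply, hf', hf]
  · exact hf'

theorem separates_surfaceGroup {ι : Type*} :
    ∀ g : ℕ, 2 ≤ g → ∀ φ : SurfaceGroup g →* FreeGroup ι, (∃ u v, ¬Commute (φ u) (φ v)) →
      Separates ∅ φ
  | g + 2, _, φ, hna => by
    obtain ⟨e, he⟩ := exists_handles_equiv (g + 2)
    let q : FreeGroup (Handles (g + 2)) →* SurfaceGroup (g + 2) :=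
      (PresentedGroup.mk (surfaceRel (g + 2))).comp (FreeGroup.map e)
    have hsurj : Function.Surjective q :=
      (PresentedGroup.mk_surjective _).comp (FreeGroup.freeGroupCongr e).surjective
    have hrel : q (boundaryWord (g + 2)) = 1 := by
      rw [MonoidHom.comp_apply, he]
      exact PresentedGroup.one_of_mem rfl
    refine separates_closed (d := boundaryWord (g + 1)) q hsurj hrel (fun f hf => ?_)
      (fun _ => mem_zpowers_addHandle) (handleSurvives_boundaryWord _ _)
      (separates_boundaryWord _) φ hna
    exact exists_lift_surfaceGroup e he f hf

end Closed

/-- Corollary 2.31 of the paper (`enfinlibre`): if `φ : π₁Σ_g →* F` is a morphism to a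
free group with non-abelian image, then for every `n` there is an automorphism `α` of
`π₁Σ_g` such that `φ ∘ α` kills no non-trivial element of the ball `Bₙ`. -/
theorem precompose_automorphism_almost_injective (g : ℕ) (hg : 2 ≤ g)
    {ι : Type*} (φ : SurfaceGroup g →* FreeGroup ι)
    (hna : ∃ u ∈ Set.range φ, ∃ v ∈ Set.range φ, u * v ≠ v * u) :
    ∀ n : ℕ, ∃ α : MulAut (SurfaceGroup g),
      ∀ w ∈ cayleyBall g n, w ≠ 1 → φ (α w) ≠ 1 := by
  intro n
  obtain ⟨_, ⟨u, rfl⟩, _, ⟨v, rfl⟩, huv⟩ := hna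
  obtain ⟨l, hl, -, h⟩ := separates_surfaceGroup g hg φ ⟨u, v, huv⟩
  refine Filter.Eventually.exists (f := l) ?_
  rw [Filter.eventually_all_finite (finite_cayleyBall g n)]
  exact fun w _ => Filter.eventually_imp_distrib_left.2 (h w)
end

section
/- Let F = FreeGroup ι be a free group, let n ≥ 1, let a₁, …, aₙ ∈ F and c ∈ F be such that c commutes with none of the aᵢ (i.e. c * aᵢ ≠ aᵢ * c for every i). Then there exists N : ℕ such that for all natural numbers k₀, k₁, …, kₙ with kⱼ ≥ N for every j, the element c^{k₀} * a₁ * c^{k₁} * a₂ * ⋯ * c^{k_{n−1}} * aₙ * c^{kₙ} is not equal to 1 in F. (Baumslag's lemma, stated as a lemma in Section 2.5 of the paper.) -/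
namespace FreeGroup

variable {α : Type*}

theorem IsReduced.exists_cancel {x y : List (α × Bool)} (hx : IsReduced x) (hy : IsReduced y) :
    ∃ x' t y', x = x' ++ t ∧ y = invRev t ++ y' ∧ IsReduced (x' ++ y') := by
  induction x using List.reverseRecOn generalizing y with
  | nil => exact ⟨[], [], y, by simp, by simp, by simpa using hy⟩
  | append_singleton x z ih =>
    by_cases h : ∃ y₀, y = (z.1, !z.2) :: y₀
    · obtain ⟨y, rfl⟩ := h
      obtain ⟨x', t, y', rfl, rfl, h⟩ :=
        ih (y := y) (hx.infix ⟨[], [z], by simp⟩) (hy.infix ⟨[(z.1, !z.2)], [], by simp⟩)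
      exact ⟨x', t ++ [z], y', by simp, by simp [invRev], h⟩
    · refine ⟨x ++ [z], [], y, by simp, by simp, ?_⟩
      refine List.isChain_append.2 ⟨hx, hy, ?_⟩
      rintro a ha ⟨b, c⟩ hb rfl
      obtain ⟨y₀, rfl⟩ : ∃ y₀, y = (a.1, c) :: y₀ := by
        cases y <;> simp_all
      obtain rfl : z = a := by simpa using ha
      by_contra hne
      exact h ⟨y₀, by rw [show c = !z.2 from Bool.eq_not_of_ne (Ne.symm hne)]⟩

theorem flatten_replicate_length {β : Type*} (L : List β) (p : ℕ) :
    (List.replicate p L).flatten.length = p * L.length := by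
  simp

theorem getElem?_flatten_replicate {β : Type*} (L : List β) {p j : ℕ} (hj : j < p * L.length) :
    (List.replicate p L).flatten[j]? = L[j % L.length]? := by
  induction p generalizing j with
  | zero => simp at hj
  | succ p ih =>
    rw [List.replicate_succ, List.flatten_cons, List.getElem?_append]
    split_ifs with h
    · rw [Nat.mod_eq_of_lt h]
    · rw [ih (by rw [add_mul] at hj; omega), ← Nat.mod_eq_sub_mod (by omega)]

theorem getElem?_of_isInfix {β : Type*} {s L : List β} {p : ℕ}
    (h : s <:+: (List.replicate p L).flatten) :
    ∃ u, ∀ i < s.length, s[i]? = L[(u + i) % L.length]? := by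
  obtain ⟨x, y, h⟩ := h
  refine ⟨x.length, fun i hi => ?_⟩
  have hlen := congrArg List.length h
  simp only [List.length_append, flatten_replicate_length] at hlen
  rw [← getElem?_flatten_replicate (p := p) L (by omega), ← h, List.append_assoc,
    List.getElem?_append_right (by omega), List.getElem?_append_left (by omega)]
  simp

theorem IsCyclicallyReduced.eq_of_getElem?_mod {L : List (α × Bool)} (hL : IsCyclicallyReduced L)
    (j : ℕ) {a b : α × Bool} (ha : L[j % L.length]? = some a)
    (hb : L[(j + 1) % L.length]? = some b) (hab : a.1 = b.1) : a.2 = b.2 := by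
  have hpos : 0 < L.length := by
    rcases L with _ | _ <;> simp_all
  have hred := (hL.flatten_replicate (j + 2)).isReduced
  have hlt : j + 1 < (j + 2) * L.length := by nlinarith
  rw [← getElem?_flatten_replicate (p := j + 2) L (by omega)] at ha
  rw [← getElem?_flatten_replicate (p := j + 2) L hlt] at hb
  obtain ⟨h₁, rfl⟩ := List.getElem?_eq_some_iff.1 ha
  obtain ⟨h₂, rfl⟩ := List.getElem?_eq_some_iff.1 hb
  exact List.isChain_iff_getElem.1 hred j h₂ hab

/-- Powers of a cyclically reduced word `L` do not contain both a word of length at least that of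
`L` and its inverse: the two occurrences would, up to the period, be mirror images of one another,
which is impossible at the centre of the reflection. -/
theorem IsCyclicallyReduced.not_isInfix_invRev {L s : List (α × Bool)} {p q : ℕ}
    (hL : IsCyclicallyReduced L) (hne : L ≠ []) (hs : L.length ≤ s.length)
    (h₁ : s <:+: (List.replicate p L).flatten) :
    ¬ invRev s <:+: (List.replicate q L).flatten := by
  intro h₂
  have hpos : 0 < L.length := List.length_pos_iff.2 hne
  obtain ⟨u, hu⟩ := getElem?_of_isInfix h₁
  obtain ⟨v, hv⟩ := getElem?_of_isInfix h₂
  have hul := Nat.mod_lt u hpos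
  have hvl := Nat.mod_lt v hpos
  obtain ⟨i, hi⟩ : ∃ i, i = (v % L.length + s.length - 1 - u % L.length) / 2 := ⟨_, rfl⟩
  have hilt : i < s.length := by omega
  have hmirror := hv (s.length - 1 - i) (by rw [invRev_length]; omega)
  rw [invRev, List.getElem?_reverse (by rw [List.length_map]; omega), List.length_map,
    List.getElem?_map, show s.length - 1 - (s.length - 1 - i) = i by omega, hu i hilt,
    ← Nat.mod_add_mod, ← Nat.mod_add_mod v] at hmirror
  obtain ⟨a, ha⟩ : ∃ a, L[(u % L.length + i) % L.length]? = some a :=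
    ⟨_, List.getElem?_eq_getElem (Nat.mod_lt _ hpos)⟩
  rw [ha, Option.map_some] at hmirror
  rcases (by omega : v % L.length + (s.length - 1 - i) = u % L.length + i ∨
    v % L.length + (s.length - 1 - i) = u % L.length + i + 1) with h | h
  · rw [h, ha] at hmirror
    simpa using congrArg Prod.snd (Option.some.inj hmirror)
  · rw [h] at hmirror
    simpa using hL.eq_of_getElem?_mod _ ha hmirror.symm rfl

/-- The elements of the free group whose reduced word has the same first and last letter as a given
cyclically reduced word. -/
def subsemigroupOfEnds [DecidableEq α] (L : List (α × Bool)) (hL : IsCyclicallyReduced L) :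
    Subsemigroup (FreeGroup α) where
  carrier := {g | g.toWord.head? = L.head? ∧ g.toWord.getLast? = L.getLast?}
  mul_mem' := by
    rintro g h ⟨hg₁, hg₂⟩ ⟨hh₁, hh₂⟩
    have hred : IsReduced (g.toWord ++ h.toWord) := by
      refine List.isChain_append.2 ⟨isReduced_toWord, isReduced_toWord, ?_⟩
      rw [hg₂, hh₁]
      exact hL.2
    rw [Set.mem_ofPred_eq, toWord_mul, hred.reduce_eq, List.head?_append, List.getLast?_append,
      hg₁, hh₁, hg₂, hh₂]
    simp

section

variable [DecidableEq α] {L : List (α × Bool)} (hL : IsCyclicallyReduced L)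

theorem mem_subsemigroupOfEnds {g : FreeGroup α} : g ∈ subsemigroupOfEnds L hL ↔
    g.toWord.head? = L.head? ∧ g.toWord.getLast? = L.getLast? := Iff.rfl

theorem one_notMem_subsemigroupOfEnds (hne : L ≠ []) : 1 ∉ subsemigroupOfEnds L hL := by
  rw [mem_subsemigroupOfEnds, toWord_one]
  rintro ⟨h, -⟩
  exact hne (List.head?_eq_none_iff.1 h.symm)

theorem pow_mem_subsemigroupOfEnds {m : ℕ} (hm : m ≠ 0) :
    mk L ^ m ∈ subsemigroupOfEnds L hL := by
  rw [mem_subsemigroupOfEnds, pow_mk, toWord_mk, (hL.flatten_replicate m).isReduced.reduce_eq,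
    List.head?_flatten_replicate hm, List.getLast?_flatten_replicate hm]
  exact ⟨rfl, rfl⟩

theorem exists_pow_mul_mul_pow_mem_subsemigroupOfEnds (hne : L ≠ []) (a : FreeGroup α) :
    ∃ p, mk L ^ p * a * mk L ^ p ∈ subsemigroupOfEnds L hL := by
  have hpos : 0 < L.length := List.length_pos_iff.2 hne
  obtain ⟨p, hp⟩ : ∃ p, p = a.toWord.length + 2 := ⟨_, rfl⟩
  have hp0 : p ≠ 0 := by omega
  have hlen : a.toWord.length + L.length < p * L.length := by subst hp; nlinarith
  have hred := (hL.flatten_replicate p).isReduced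
  obtain ⟨x, t, a', hx, ha, hxa⟩ := hred.exists_cancel (isReduced_toWord (x := a))
  obtain ⟨z, s, y, hz, hy, hzy⟩ := hxa.exists_cancel hred
  have hx_len := congrArg List.length hx
  have ha_len := congrArg List.length ha
  have hz_len := congrArg List.length hz
  have hy_len := congrArg List.length hy
  simp only [List.length_append, flatten_replicate_length, invRev_length] at *
  have hs : s.length < a'.length + L.length := by
    by_contra! hs
    obtain ⟨r, rfl, rfl⟩ : ∃ r, x = z ++ r ∧ s = r ++ a' := by
      rcases List.append_eq_append_iff.1 hz with ⟨r, rfl, rfl⟩ | ⟨r, rfl, rfl⟩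
      · simp only [List.length_append] at hs
        omega
      · exact ⟨r, rfl, rfl⟩
    rw [List.length_append] at hs
    refine hL.not_isInfix_invRev hne (p := p) (q := p) (s := r) (by omega) ⟨z, t, hx.symm⟩
      ⟨invRev a', y, ?_⟩
    rw [hy, invRev_append]
  have hword : (mk L ^ p * a * mk L ^ p).toWord = z ++ y := by
    rw [← hzy.reduce_eq, ← toWord_mk]
    congr 1
    calc mk L ^ p * a * mk L ^ p = mk x * mk t * (mk (invRev t) * mk a') * mk L ^ p := by
          rw [mul_mk, mul_mk, ← hx, ← ha, mk_toWord, pow_mk]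
      _ = mk (x ++ a') * mk L ^ p := by rw [← inv_mk, ← mul_mk]; group
      _ = mk z * mk s * (mk (invRev s) * mk y) := by simp only [hz, pow_mk, hy, mul_mk]
      _ = mk (z ++ y) := by rw [← inv_mk, ← mul_mk]; group
  have hx0 : x ≠ [] := List.length_pos_iff.1 (by omega)
  have hz0 : z ≠ [] := List.length_pos_iff.1 (by omega)
  have hy0 : y ≠ [] := List.length_pos_iff.1 (by omega)
  refine ⟨p, ?_⟩
  rw [mem_subsemigroupOfEnds, hword, ← List.head?_flatten_replicate (l := L) hp0,
    ← List.getLast?_flatten_replicate (l := L) hp0]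
  constructor
  · rw [hx, List.head?_append_of_ne_nil _ hx0, ← List.head?_append_of_ne_nil x (l₂ := a') hx0, hz]
    rw [List.head?_append_of_ne_nil _ hz0, List.head?_append_of_ne_nil _ hz0]
  · rw [hy, List.getLast?_append_of_ne_nil _ hy0, List.getLast?_append_of_ne_nil _ hy0]

theorem eventually_pow_mul_mul_pow_mem_subsemigroupOfEnds (hne : L ≠ []) (a : FreeGroup α) :
    ∀ᶠ p in Filter.atTop, ∀ m ≥ p, mk L ^ m * a * mk L ^ p ∈ subsemigroupOfEnds L hL := by
  obtain ⟨p, hp⟩ := exists_pow_mul_mul_pow_mem_subsemigroupOfEnds hL hne a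
  filter_upwards [Filter.eventually_gt_atTop p] with q hq m hm
  obtain ⟨i, rfl⟩ := Nat.exists_eq_add_of_lt hq
  obtain ⟨j, rfl⟩ := Nat.exists_eq_add_of_le hm
  have hi := pow_mem_subsemigroupOfEnds hL (m := i + 1) (by omega)
  have hj := pow_mem_subsemigroupOfEnds hL (m := i + 1 + j) (by omega)
  convert mul_mem (mul_mem hj hp) hi using 1
  rw [show p + i + 1 + j = (i + 1 + j) + p by ring, add_assoc p, pow_add _ _ p, pow_add _ p]
  simp only [mul_assoc]

end

end FreeGroup

theorem Subsemigroup.pow_mul_prod_ofFn_mem {M : Type*} [Monoid M] (S : Subsemigroup M) {c : M}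
    {p : ℕ} (hc : ∀ m ≥ p, c ^ m ∈ S) {n : ℕ} {a : Fin n → M}
    (ha : ∀ i, ∀ m ≥ p, c ^ m * a i * c ^ p ∈ S) {k : Fin n → ℕ} (hk : ∀ i, 2 * p ≤ k i)
    {m : ℕ} (hm : p ≤ m) : c ^ m * (List.ofFn fun i => a i * c ^ k i).prod ∈ S := by
  induction n generalizing m with
  | zero => simpa using hc m hm
  | succ n ih =>
    have hk0 := hk 0
    have hrest := ih (fun i => ha i.succ) (fun i => hk i.succ) (m := k 0 - p) (by omega)
    convert mul_mem (ha 0 m hm) hrest using 1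
    rw [List.ofFn_succ, List.prod_cons, show c ^ k 0 = c ^ p * c ^ (k 0 - p) by
      rw [← pow_add]; congr 1; omega]
    simp only [mul_assoc]

/-- Baumslag's lemma (Section 2.5 of the paper): if `c` commutes with none of
`a₁, …, aₙ` in a free group, then for all sufficiently large exponents `k₀, …, kₙ`, the
element `c^{k₀} a₁ c^{k₁} a₂ ⋯ c^{k_{n−1}} aₙ c^{kₙ}` is non-trivial. -/
theorem baumslag_lemma {ι : Type*} (n : ℕ) (hn : 1 ≤ n)
    (a : Fin n → FreeGroup ι) (c : FreeGroup ι)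
    (hc : ∀ i : Fin n, c * a i ≠ a i * c) :
    ∃ N : ℕ, ∀ k : Fin (n + 1) → ℕ, (∀ j, N ≤ k j) →
      c ^ (k 0) * (List.ofFn fun i : Fin n => a i * c ^ (k i.succ)).prod ≠ 1 := by
  classical
  have hc1 : c ≠ 1 := by
    rintro rfl
    exact hc ⟨0, hn⟩ (by simp)
  let L := FreeGroup.reduceCyclically c.toWord
  let φ := MulAut.conj (FreeGroup.mk (FreeGroup.reduceCyclically.conjugator c.toWord))⁻¹
  have hL : FreeGroup.IsCyclicallyReduced L :=
    FreeGroup.reduceCyclically.isCyclicallyReduced FreeGroup.isReduced_toWord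
  have hφ : φ c = FreeGroup.mk L := by
    conv_lhs => rw [← FreeGroup.mk_toWord (x := c),
      ← FreeGroup.reduceCyclically.conj_conjugator_reduceCyclically c.toWord]
    simp only [φ, L, MulAut.conj_apply, ← FreeGroup.mul_mk, ← FreeGroup.inv_mk]
    group
  have hne : L ≠ [] := by
    intro h
    rw [h, ← FreeGroup.one_eq_mk, map_eq_one_iff φ φ.injective] at hφ
    exact hc1 hφ
  obtain ⟨p, hp, hp0⟩ := ((Filter.eventually_all.2 fun i =>
    FreeGroup.eventually_pow_mul_mul_pow_mem_subsemigroupOfEnds hL hne (φ (a i))).and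
      (Filter.eventually_ne_atTop 0)).exists
  refine ⟨2 * p, fun k hk h => FreeGroup.one_notMem_subsemigroupOfEnds hL hne ?_⟩
  have hmem := Subsemigroup.pow_mul_prod_ofFn_mem _
    (fun m hm => FreeGroup.pow_mem_subsemigroupOfEnds hL (by omega)) hp
    (fun i => hk i.succ) (m := k 0) (by have := hk 0; omega)
  convert hmem using 1
  rw [← map_one φ, ← h, ← hφ]
  simp [map_list_prod, List.map_ofFn, Function.comp_def]
end
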